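/- arXiv:2106.04136 — 4 statements merged into one kernel-verified Lean document; each statement's English description precedes it below -/
import Mathlib

section
/- Let B be a commutative Noetherian integral domain. Then B is integrally closed in its fraction field Q(B) if and only if B is DCK-integrally closed. -/
/-- Let `B` be a commutative Noetherian integral domain. Then `B` is integrally
closed in its fraction field `Q(B)` if and only if `B` is DCK-integrally closed, i.e. for every
subring `R` of `Q(B)` such that `B ⊆ R ⊆ z⁻¹B` for some nonzero `z ∈ B`, one has `R = B`. -/
theorem stmt_0 (B : Type*) [CommRing B] [IsDomain B] [IsNoetherianRing B] :
    (∀ x : FractionRing B, IsIntegral B x →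
        x ∈ (algebraMap B (FractionRing B)).range) ↔
    (∀ R : Subring (FractionRing B),
        (algebraMap B (FractionRing B)).range ≤ R →
        (∃ z : B, z ≠ 0 ∧ ∀ x ∈ R,
            algebraMap B (FractionRing B) z * x ∈ (algebraMap B (FractionRing B)).range) →
        R = (algebraMap B (FractionRing B)).range) := by
  constructor
  · rintro h R hR ⟨z, hz, hzR⟩
    refine le_antisymm (fun x hx => h x ?_) hR
    refine IsAlmostIntegral.isIntegral ⟨z, mem_nonZeroDivisors_of_ne_zero hz, fun n => ?_⟩
    rw [Algebra.smul_def]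
    exact hzR _ (pow_mem hx n)
  · intro h x hx
    obtain ⟨z, hz, hzR⟩ := FractionalIdeal.isFractional_of_fg
      (S := nonZeroDivisors B) hx.fg_adjoin_singleton
    rw [← h (Algebra.adjoin B {x}).toSubring ?_ ⟨z, nonZeroDivisors.ne_zero hz, fun y hy => ?_⟩]
    · exact Algebra.self_mem_adjoin_singleton B x
    · rintro _ ⟨b, rfl⟩
      exact (Algebra.adjoin B {x}).algebraMap_mem b
    · rw [← Algebra.smul_def]
      exact hzR y hy
end

section
/- Let A be a ring with no nontrivial zero divisors whose center Z = Z(A) is a Noetherian ring, and suppose Q(A) := Q(Z) ⊗_Z A is finite dimensional as a vector space over the fraction field Q(Z). Then A is DCK-integrally closed if and only if A is a maximal order of Q(A). -/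
set_option synthInstance.maxHeartbeats 1000000

open scoped TensorProduct

noncomputable section

variable (A : Type*) [Ring A]

/-- The center `Z = Z(A)` of `A`. -/
abbrev ZC := Subring.center A

/-- The fraction field `Q(Z)` of the center. -/
abbrev QZ := FractionRing (ZC A)

/-- `Q(A) := Q(Z) ⊗_Z A`. -/
abbrev QA := (QZ A) ⊗[ZC A] A

/-- The canonical image `Ā` of `A` in `Q(A)`, as a subring of `Q(A)`. -/
abbrev Abar : Subring (QA A) :=
  (Algebra.TensorProduct.includeRight : A →ₐ[ZC A] QA A).toRingHom.range

/-- `A` is DCK-integrally closed: for every subring `R` of `Q(A)` with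
`Ā ⊆ R ⊆ z⁻¹Ā` for some nonzero central `z`, one has `R = Ā`. -/
def IsDCKIntegrallyClosed : Prop :=
  ∀ R : Subring (QA A), Abar A ≤ R →
    (∃ z : ZC A, z ≠ 0 ∧ ∀ x ∈ R, algebraMap (ZC A) (QA A) z * x ∈ Abar A) →
    R = Abar A

/-- A subring `B` of `Q(A)` is a classical order of `Q(A)`: it contains the image of `Z`,
it is finitely generated as a `Z`-module, and its `Q(Z)`-linear span is all of `Q(A)`. -/
def IsClassicalOrder (B : Subring (QA A)) : Prop :=
  (algebraMap (ZC A) (QA A)).range ≤ B ∧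
  (Submodule.span (ZC A) (B : Set (QA A))).FG ∧
  Submodule.span (QZ A) (B : Set (QA A)) = ⊤

/-- `A` is a maximal order of `Q(A)`: its canonical image `Ā` is a classical order and every
classical order of `Q(A)` containing `Ā` equals `Ā`. -/
def IsMaximalOrder : Prop :=
  IsClassicalOrder A (Abar A) ∧
  ∀ B : Subring (QA A), IsClassicalOrder A B → Abar A ≤ B → B = Abar A

/-- In a finite-dimensional central division algebra, two-sided multiplications exhaust the
linear endomorphisms. -/
theorem mulLeftRight_surjective_of_isDomain (K D : Type*) [Field K] [Ring D] [IsDomain D]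
    [Algebra K D] [FiniteDimensional K D] [Algebra.IsCentral K D] :
    Function.Surjective (AlgHom.mulLeftRight K D) := by
  classical
  intro f
  have mem (a b : D) : AlgHom.mulLeftRight K D (a ⊗ₜ MulOpposite.op b) ∈
      (AlgHom.mulLeftRight K D).range := ⟨_, rfl⟩
  have hsimple : IsSimpleModule (AlgHom.mulLeftRight K D).range D := by
    rw [isSimpleModule_iff_toSpanSingleton_surjective]
    refine ⟨inferInstance, fun x hx y => ?_⟩
    obtain ⟨w, hw⟩ := FiniteDimensional.exists_mul_eq_one K hx
    have hw' : w * x = 1 := mul_eq_one_symm hw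
    refine ⟨⟨_, mem (y * w) 1⟩, ?_⟩
    change AlgHom.mulLeftRight K D ((y * w) ⊗ₜ MulOpposite.op 1) x = y
    simp [mul_assoc, hw']
  have hcomm (φ : Module.End (AlgHom.mulLeftRight K D).range D) :
      ∃ c : K, ∀ x, φ x = c • x := by
    have key (a b x : D) : φ (a * x * b) = a * φ x * b := by
      have := φ.map_smul ⟨_, mem a b⟩ x
      change φ (AlgHom.mulLeftRight K D (a ⊗ₜ MulOpposite.op b) x) =
        AlgHom.mulLeftRight K D (a ⊗ₜ MulOpposite.op b) (φ x) at this
      simpa using this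
    have hl (x : D) : φ x = x * φ 1 := by simpa using key x 1 1
    have hr (x : D) : φ x = φ 1 * x := by simpa using key 1 x 1
    have : φ 1 ∈ Subalgebra.center K D :=
      Subalgebra.mem_center_iff.mpr fun b => by rw [← hl, hr]
    obtain ⟨c, hc⟩ := (Algebra.IsCentral.mem_center_iff K).mp this
    exact ⟨c, fun x => by rw [hr, hc, Algebra.smul_def]⟩
  let g : Module.End (Module.End (AlgHom.mulLeftRight K D).range D) D :=
    { toFun := f
      map_add' := f.map_add
      map_smul' := fun φ x => by
        obtain ⟨c, hc⟩ := hcomm φ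
        simp [hc] }
  let b := Module.finBasis K D
  obtain ⟨⟨_, t, rfl⟩, hr⟩ := jacobson_density (R := (AlgHom.mulLeftRight K D).range) (M := D)
    g (Finset.univ.image b)
  refine ⟨t, b.ext fun i => ?_⟩
  exact (hr (b i) (by simp)).symm

theorem algebraMap_QA_apply (z : ZC A) :
    algebraMap (ZC A) (QA A) z = (1 : QZ A) ⊗ₜ[ZC A] (z : A) := by
  rw [← (Algebra.TensorProduct.includeRight : A →ₐ[ZC A] QA A).commutes]
  rfl

theorem algebraMap_QA_mem_Abar (z : ZC A) : algebraMap (ZC A) (QA A) z ∈ Abar A :=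
  ⟨z, (algebraMap_QA_apply A z).symm⟩

theorem smul_QA_eq (z : ZC A) (q : QA A) : z • q = algebraMap (ZC A) (QA A) z * q :=
  Algebra.smul_def z q

theorem algebraMap_smul_QA_eq (z : ZC A) (q : QA A) :
    algebraMap (ZC A) (QZ A) z • q = algebraMap (ZC A) (QA A) z * q :=
  Algebra.smul_def (algebraMap (ZC A) (QZ A) z) q

theorem exists_ne_zero_algebraMap_mul_mem_Abar [IsDomain A] (q : QA A) :
    ∃ z : ZC A, z ≠ 0 ∧ algebraMap (ZC A) (QA A) z * q ∈ Abar A := by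
  have h := (isLocalizedModule_iff_isBaseChange (nonZeroDivisors (ZC A)) (QZ A)
    (TensorProduct.mk (ZC A) (QZ A) A 1)).mpr (TensorProduct.isBaseChange _ _ _)
  obtain ⟨⟨a, s⟩, hs⟩ := h.surj q
  refine ⟨s, nonZeroDivisors.ne_zero s.2, a, ?_⟩
  rw [← smul_QA_eq]
  exact hs.symm

theorem includeRight_QA_injective [IsDomain A] :
    Function.Injective (Algebra.TensorProduct.includeRight : A →ₐ[ZC A] QA A) := by
  have h := (isLocalizedModule_iff_isBaseChange (nonZeroDivisors (ZC A)) (QZ A)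
    (TensorProduct.mk (ZC A) (QZ A) A 1)).mpr (TensorProduct.isBaseChange _ _ _)
  rw [injective_iff_map_eq_zero]
  intro a ha
  obtain ⟨s, hs⟩ := (IsLocalizedModule.eq_zero_iff (nonZeroDivisors (ZC A))
    (TensorProduct.mk (ZC A) (QZ A) A 1)).mp ha
  have hs0 : ((s : ZC A) : A) ≠ 0 := fun h0 => nonZeroDivisors.ne_zero s.2 (Subtype.ext h0)
  exact (mul_eq_zero.mp (show ((s : ZC A) : A) * a = 0 from hs)).resolve_left hs0

theorem algebraMap_QA_smul_cancel [IsDomain A] {z : ZC A} (hz : z ≠ 0) {p q : QA A}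
    (h : algebraMap (ZC A) (QA A) z * p = algebraMap (ZC A) (QA A) z * q) : p = q := by
  have hz' : algebraMap (ZC A) (QZ A) z ≠ 0 := by simpa using hz
  rw [← algebraMap_smul_QA_eq, ← algebraMap_smul_QA_eq] at h
  exact smul_right_injective _ hz' h

instance QA.instIsDomain [IsDomain A] : IsDomain (QA A) := by
  have : Nontrivial (QA A) := (includeRight_QA_injective A).nontrivial
  have : NoZeroDivisors (QA A) := by
    refine ⟨fun {p q} hpq => ?_⟩
    obtain ⟨z, hz, a, ha⟩ := exists_ne_zero_algebraMap_mul_mem_Abar A p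
    obtain ⟨w, hw, b, hb⟩ := exists_ne_zero_algebraMap_mul_mem_Abar A q
    have hab : a * b = 0 := by
      apply includeRight_QA_injective A
      rw [map_mul, map_zero]
      refine (congrArg₂ (· * ·) ha hb).trans ?_
      rw [mul_assoc, ← mul_assoc p, ← Algebra.commutes w p, mul_assoc, hpq, mul_zero, mul_zero]
    rcases mul_eq_zero.mp hab with rfl | rfl
    · left
      rw [map_zero] at ha
      exact algebraMap_QA_smul_cancel A hz (by rw [← ha, mul_zero])
    · right
      rw [map_zero] at hb
      exact algebraMap_QA_smul_cancel A hw (by rw [← hb, mul_zero])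
  exact NoZeroDivisors.to_isDomain _

theorem exists_eq_algebraMap_of_mem_Abar_of_commute [IsDomain A] {q : QA A} (hq : q ∈ Abar A)
    (hc : ∀ p, p * q = q * p) : ∃ z : ZC A, q = algebraMap (ZC A) (QA A) z := by
  obtain ⟨a, rfl⟩ := hq
  suffices ha : a ∈ Subring.center A from ⟨⟨a, ha⟩, (algebraMap_QA_apply A ⟨a, ha⟩).symm⟩
  refine Subring.mem_center_iff.mpr fun b => ?_
  apply includeRight_QA_injective A
  rw [map_mul, map_mul]
  exact hc _

instance QA.instIsCentral [IsDomain A] : Algebra.IsCentral (QZ A) (QA A) := by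
  refine ⟨fun q hq => ?_⟩
  rw [Subalgebra.mem_center_iff] at hq
  obtain ⟨z, hz, ha⟩ := exists_ne_zero_algebraMap_mul_mem_Abar A q
  obtain ⟨w, hw⟩ := exists_eq_algebraMap_of_mem_Abar_of_commute A ha fun p => by
    rw [← mul_assoc, ← Algebra.commutes, mul_assoc, hq, mul_assoc]
  rw [Algebra.mem_bot]
  refine ⟨algebraMap _ _ w / algebraMap _ _ z, ?_⟩
  have hz' : algebraMap (ZC A) (QZ A) z ≠ 0 := by simpa using hz
  apply algebraMap_QA_smul_cancel A hz
  rw [hw, IsScalarTower.algebraMap_apply (ZC A) (QZ A) (QA A),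
    IsScalarTower.algebraMap_apply (ZC A) (QZ A) (QA A), ← map_mul, mul_div_cancel₀ _ hz']

/-- Two-sided multiplication operators have bounded denominators on `Ā`. -/
theorem exists_ne_zero_algebraMap_mul_mulLeftRight_mem_Abar [IsDomain A]
    (t : QA A ⊗[QZ A] (QA A)ᵐᵒᵖ) :
    ∃ z : ZC A, z ≠ 0 ∧ ∀ x ∈ Abar A,
      algebraMap (ZC A) (QA A) z * AlgHom.mulLeftRight (QZ A) (QA A) t x ∈ Abar A := by
  induction t using TensorProduct.induction_on with
  | zero => exact ⟨1, one_ne_zero, fun x _ => by simp⟩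
  | tmul p q =>
    obtain ⟨z, hz, ha⟩ := exists_ne_zero_algebraMap_mul_mem_Abar A p
    obtain ⟨w, hw, hb⟩ := exists_ne_zero_algebraMap_mul_mem_Abar A q.unop
    refine ⟨z * w, mul_ne_zero hz hw, fun x hx => ?_⟩
    have := mul_mem (mul_mem ha hx) hb
    rw [AlgHom.mulLeftRight_apply, map_mul]
    convert this using 1
    rw [mul_assoc _ _ (p * x * q.unop), ← mul_assoc _ (p * x), Algebra.commutes w (p * x)]
    simp only [mul_assoc]
  | add s t hs ht =>
    obtain ⟨z, hz, ha⟩ := hs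
    obtain ⟨w, hw, hb⟩ := ht
    refine ⟨z * w, mul_ne_zero hz hw, fun x hx => ?_⟩
    have h1 := mul_mem (algebraMap_QA_mem_Abar A w) (ha x hx)
    have h2 := mul_mem (algebraMap_QA_mem_Abar A z) (hb x hx)
    convert add_mem h1 h2 using 1
    rw [← mul_assoc, ← mul_assoc, ← map_mul, ← map_mul, mul_comm w z, ← mul_add]
    simp

theorem exists_ne_zero_forall_algebraMap_mul_mem_Abar [IsDomain A] {κ : Type*} (s : Finset κ)
    (f : κ → QA A → QA A)
    (h : ∀ i ∈ s, ∃ z : ZC A, z ≠ 0 ∧ ∀ x ∈ Abar A, algebraMap (ZC A) (QA A) z * f i x ∈ Abar A) :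
    ∃ z : ZC A, z ≠ 0 ∧ ∀ i ∈ s, ∀ x ∈ Abar A, algebraMap (ZC A) (QA A) z * f i x ∈ Abar A := by
  classical
  induction s using Finset.induction_on with
  | empty => exact ⟨1, one_ne_zero, by simp⟩
  | insert i s _ ih =>
    obtain ⟨z, hz, ha⟩ := h i (by simp)
    obtain ⟨w, hw, hb⟩ := ih fun j hj => h j (by simp [hj])
    refine ⟨z * w, mul_ne_zero hz hw, fun j hj x hx => ?_⟩
    rw [map_mul]
    rcases Finset.mem_insert.mp hj with rfl | hj
    · rw [← map_mul, mul_comm, map_mul, mul_assoc]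
      exact mul_mem (algebraMap_QA_mem_Abar A w) (ha x hx)
    · rw [mul_assoc]
      exact mul_mem (algebraMap_QA_mem_Abar A z) (hb j hj x hx)

/-- If the center is Noetherian, then `Ā` is a finitely generated module over it. -/
theorem span_Abar_fg [IsDomain A] [IsNoetherianRing (ZC A)] [Module.Finite (QZ A) (QA A)] :
    (Submodule.span (ZC A) (Abar A : Set (QA A))).FG := by
  let b := Module.finBasis (QZ A) (QA A)
  obtain ⟨z, hz, hzb⟩ := exists_ne_zero_forall_algebraMap_mul_mem_Abar A Finset.univ
    (fun i x => algebraMap (QZ A) (QA A) (b.repr x i)) fun i _ => by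
      obtain ⟨t, ht⟩ := mulLeftRight_surjective_of_isDomain (QZ A) (QA A)
        ((Algebra.linearMap (QZ A) (QA A)) ∘ₗ b.coord i)
      obtain ⟨z, hz, h⟩ := exists_ne_zero_algebraMap_mul_mulLeftRight_mem_Abar A t
      exact ⟨z, hz, fun x hx => by simpa [ht] using h x hx⟩
  have hz' : algebraMap (ZC A) (QZ A) z ≠ 0 := by simpa using hz
  let c := fun i => (algebraMap (ZC A) (QZ A) z)⁻¹ • b i
  refine Submodule.FG.of_le (Submodule.fg_span (Set.finite_range c))
    (Submodule.span_le.mpr fun x hx => ?_)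
  rw [SetLike.mem_coe, ← b.sum_repr x]
  refine Submodule.sum_mem _ fun i _ => ?_
  obtain ⟨w, hw⟩ := exists_eq_algebraMap_of_mem_Abar_of_commute A (hzb i (Finset.mem_univ i) x hx)
    fun p => by
      rw [IsScalarTower.algebraMap_apply (ZC A) (QZ A) (QA A), ← map_mul]
      exact (Algebra.commutes _ p).symm
  have hw' : algebraMap (ZC A) (QZ A) z * b.repr x i = algebraMap (ZC A) (QZ A) w := by
    apply (algebraMap (QZ A) (QA A)).injective
    rw [map_mul, ← IsScalarTower.algebraMap_apply, ← IsScalarTower.algebraMap_apply, hw]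
  have : b.repr x i • b i = w • c i := by
    rw [← algebraMap_smul (QZ A) w, ← hw', smul_smul, mul_right_comm, mul_inv_cancel₀ hz', one_mul]
  rw [this]
  exact Submodule.smul_mem _ _ (Submodule.subset_span ⟨i, rfl⟩)

theorem span_QZ_Abar [IsDomain A] : Submodule.span (QZ A) (Abar A : Set (QA A)) = ⊤ := by
  rw [eq_top_iff]
  intro q _
  obtain ⟨z, hz, ha⟩ := exists_ne_zero_algebraMap_mul_mem_Abar A q
  have hz' : algebraMap (ZC A) (QZ A) z ≠ 0 := by simpa using hz
  rw [← inv_smul_smul₀ hz' q]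
  refine Submodule.smul_mem _ _ (Submodule.subset_span ?_)
  rwa [algebraMap_smul_QA_eq]

theorem isClassicalOrder_Abar [IsDomain A] [IsNoetherianRing (ZC A)]
    [Module.Finite (QZ A) (QA A)] : IsClassicalOrder A (Abar A) := by
  refine ⟨?_, span_Abar_fg A, span_QZ_Abar A⟩
  rintro _ ⟨z, rfl⟩
  exact algebraMap_QA_mem_Abar A z

/-- A finitely generated `Z`-submodule of `Q(A)` has a common denominator. -/
theorem exists_ne_zero_algebraMap_mul_mem_Abar_of_fg [IsDomain A] {N : Submodule (ZC A) (QA A)}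
    (hN : N.FG) :
    ∃ z : ZC A, z ≠ 0 ∧ ∀ x ∈ N, algebraMap (ZC A) (QA A) z * x ∈ Abar A := by
  obtain ⟨s, rfl⟩ := hN
  obtain ⟨z, hz, h⟩ := exists_ne_zero_forall_algebraMap_mul_mem_Abar A s (fun q x => q * x)
    fun q _ => by
      obtain ⟨z, hz, ha⟩ := exists_ne_zero_algebraMap_mul_mem_Abar A q
      exact ⟨z, hz, fun x hx => by rw [← mul_assoc]; exact mul_mem ha hx⟩
  refine ⟨z, hz, fun x hx => ?_⟩
  induction hx using Submodule.span_induction with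
  | mem x hx => simpa using h x hx 1 (one_mem _)
  | zero => rw [mul_zero]; exact zero_mem _
  | add x y _ _ hx hy => rw [mul_add]; exact add_mem hx hy
  | smul w x _ hx =>
    rw [mul_smul_comm, smul_QA_eq]
    exact mul_mem (algebraMap_QA_mem_Abar A w) hx

theorem IsClassicalOrder.of_Abar_le [IsDomain A] [IsNoetherianRing (ZC A)]
    (hA : IsClassicalOrder A (Abar A)) {R : Subring (QA A)} (hR : Abar A ≤ R) {z : ZC A}
    (hz : z ≠ 0) (hzR : ∀ x ∈ R, algebraMap (ZC A) (QA A) z * x ∈ Abar A) :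
    IsClassicalOrder A R := by
  refine ⟨hA.1.trans hR, ?_, eq_top_iff.mpr (hA.2.2.ge.trans (Submodule.span_mono hR))⟩
  let m := LinearMap.mulLeft (ZC A) (algebraMap (ZC A) (QA A) z)
  have hm : Function.Injective m := fun _ _ h => algebraMap_QA_smul_cancel A hz h
  refine Submodule.fg_of_fg_map_injective m hm (Submodule.FG.of_le hA.2.1 ?_)
  rw [Submodule.map_span]
  refine Submodule.span_mono ?_
  rintro _ ⟨x, hx, rfl⟩
  exact hzR x hx

/-- Let `A` be a ring with no nontrivial zero divisors whose center `Z` is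
Noetherian, and suppose `Q(A) = Q(Z) ⊗_Z A` is finite dimensional over the fraction field
`Q(Z)`. Then `A` is DCK-integrally closed if and only if `A` is a maximal order of `Q(A)`. -/
theorem stmt_2 [IsDomain A] [IsNoetherianRing (ZC A)]
    [Module.Finite (QZ A) (QA A)] :
    IsDCKIntegrallyClosed A ↔ IsMaximalOrder A := by
  constructor
  · intro h
    refine ⟨isClassicalOrder_Abar A, fun B hB hAB => h B hAB ?_⟩
    obtain ⟨z, hz, hzB⟩ := exists_ne_zero_algebraMap_mul_mem_Abar_of_fg A hB.2.1
    exact ⟨z, hz, fun x hx => hzB x (Submodule.subset_span hx)⟩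
  · rintro ⟨hA, hmax⟩ R hR ⟨z, hz, hzR⟩
    exact hmax R (IsClassicalOrder.of_Abar_le A hA hR hz hzR) hR

end
end

section
/- The ℂ[q,q⁻¹]-algebra 𝓛^A is (left and right) Noetherian, and for every q₀ ∈ ℂ ∖ {0, 1} the ℂ-algebra 𝓛(q₀) is (left and right) Noetherian. -/
noncomputable section

variable (R : Type*) [CommRing R]

/-- Generators. -/
def gA : FreeAlgebra R (Fin 4) := FreeAlgebra.ι R 0
def gB : FreeAlgebra R (Fin 4) := FreeAlgebra.ι R 1
def gC : FreeAlgebra R (Fin 4) := FreeAlgebra.ι R 2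
def gD : FreeAlgebra R (Fin 4) := FreeAlgebra.ι R 3

/-- Defining relations of 𝓛₀,₁, with `s` standing for `q²` and `t` for `q⁻²`. -/
inductive LRel (s t : R) : FreeAlgebra R (Fin 4) → FreeAlgebra R (Fin 4) → Prop
  | rel1 : LRel s t (gA R * gD R) (gD R * gA R)
  | rel2 : LRel s t (gA R * gB R - gB R * gA R)
      (-(algebraMap R (FreeAlgebra R (Fin 4)) (1 - t) * (gB R * gD R)))
  | rel3 : LRel s t (gD R * gB R) (algebraMap R (FreeAlgebra R (Fin 4)) s * (gB R * gD R))
  | rel4 : LRel s t (gC R * gB R - gB R * gC R)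
      (algebraMap R (FreeAlgebra R (Fin 4)) (1 - t) * (gD R * gA R - gD R * gD R))
  | rel5 : LRel s t (gC R * gD R) (algebraMap R (FreeAlgebra R (Fin 4)) s * (gD R * gC R))
  | rel6 : LRel s t (gA R * gC R - gC R * gA R)
      (algebraMap R (FreeAlgebra R (Fin 4)) (1 - t) * (gD R * gC R))
  | rel7 : LRel s t (gA R * gD R - algebraMap R (FreeAlgebra R (Fin 4)) s * (gB R * gC R)) 1

/-- The quantum loop algebra with parameters `s = q²`, `t = q⁻²`. -/
def QLoop (s t : R) : Type _ := RingQuot (LRel R s t)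

instance (s t : R) : Ring (QLoop R s t) := RingQuot.instRing _
instance (s t : R) : Algebra R (QLoop R s t) := RingQuot.instAlgebra _

/-- The generators a, b, c, d of the quantum loop algebra. -/
def qa (s t : R) : QLoop R s t := RingQuot.mkAlgHom R (LRel R s t) (gA R)
def qb (s t : R) : QLoop R s t := RingQuot.mkAlgHom R (LRel R s t) (gB R)
def qc (s t : R) : QLoop R s t := RingQuot.mkAlgHom R (LRel R s t) (gC R)
def qd (s t : R) : QLoop R s t := RingQuot.mkAlgHom R (LRel R s t) (gD R)

/-- The specialization 𝓛(q₀) at q = q₀ ∈ ℂ. -/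
def Lspec (q₀ : ℂ) : Type := QLoop ℂ (q₀ ^ 2) ((q₀ ^ 2)⁻¹)

instance (q₀ : ℂ) : Ring (Lspec q₀) := inferInstanceAs (Ring (QLoop ℂ _ _))
instance (q₀ : ℂ) : Algebra ℂ (Lspec q₀) := inferInstanceAs (Algebra ℂ (QLoop ℂ _ _))

/-- The integral form 𝓛^A over ℂ[q, q⁻¹]. -/
def LA : Type _ :=
  QLoop (LaurentPolynomial ℂ) (LaurentPolynomial.T 2) (LaurentPolynomial.T (-2))


instance : Ring LA := inferInstanceAs (Ring (QLoop (LaurentPolynomial ℂ) _ _))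
instance : Algebra (LaurentPolynomial ℂ) LA :=
  inferInstanceAs (Algebra (LaurentPolynomial ℂ) (QLoop (LaurentPolynomial ℂ) _ _))

section OreFiltration

variable {A S : Type*} [Ring A] [Ring S]

/-- `x` normalizes the image of `f : A →+* S` up to lower-order terms: `x A + A = A x + A`. -/
structure AlmostNormalizes (f : A →+* S) (x : S) : Prop where
  left : ∀ r, ∃ u v, x * f r = f u * x + f v
  right : ∀ r, ∃ u v, f r * x = x * f u + f v

theorem AlmostNormalizes.op {f : A →+* S} {x : S} (h : AlmostNormalizes f x) :
    AlmostNormalizes (RingHom.op f) (MulOpposite.op x) where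
  left r := by
    obtain ⟨u, v, e⟩ := h.right r.unop
    exact ⟨.op u, .op v, MulOpposite.unop_injective (by simpa using e)⟩
  right r := by
    obtain ⟨u, v, e⟩ := h.left r.unop
    exact ⟨.op u, .op v, MulOpposite.unop_injective (by simpa using e)⟩

variable [Module A S]

/-- The left `A`-submodule of `S` spanned by `x ^ i` for `i < n`. -/
def powFiltration (A : Type*) {S : Type*} [Ring A] [Ring S] [Module A S] (x : S) (n : ℕ) :
    Submodule A S :=
  Submodule.span A ((fun i => x ^ i) '' Set.Iio n)

theorem pow_mem_powFiltration (x : S) {i n : ℕ} (h : i < n) : x ^ i ∈ powFiltration A x n :=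
  Submodule.subset_span ⟨i, h, rfl⟩

theorem powFiltration_mono (x : S) : Monotone (powFiltration A x) := fun _ _ h =>
  Submodule.span_mono (Set.image_mono fun _ hi => lt_of_lt_of_le hi h)

theorem powFiltration_fg (x : S) (n : ℕ) : (powFiltration A x n).FG :=
  Submodule.fg_span ((Set.finite_Iio n).image _)

variable {f : A →+* S} (hf : ∀ (r : A) (s : S), r • s = f r * s) {x : S}
include hf

theorem map_mul_mem_powFiltration {n : ℕ} {y : S} (r : A) (hy : y ∈ powFiltration A x n) :
    f r * y ∈ powFiltration A x n := by
  rw [← hf]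
  exact Submodule.smul_mem _ _ hy

theorem powFiltration_induction {n : ℕ} {p : S → Prop} (h0 : p 0)
    (hadd : ∀ y z, p y → p z → p (y + z)) (hpow : ∀ r, ∀ i < n, p (f r * x ^ i)) {y : S}
    (hy : y ∈ powFiltration A x n) : p y := by
  refine Submodule.closure_induction (p := fun y _ => p y) h0 (fun y z _ _ => hadd y z) ?_ hy
  rintro r - ⟨i, hi, rfl⟩
  simpa only [hf] using hpow r i hi

variable (hx : AlmostNormalizes f x)
include hx

theorem mul_mem_powFiltration_succ {n : ℕ} {y : S} (hy : y ∈ powFiltration A x n) :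
    x * y ∈ powFiltration A x (n + 1) := by
  refine powFiltration_induction hf (p := fun y => x * y ∈ powFiltration A x (n + 1)) (by simp)
    (fun y z hy hz => ?_) (fun r i hi => ?_) hy
  · rw [mul_add]
    exact add_mem hy hz
  · obtain ⟨u, v, e⟩ := hx.left r
    rw [← mul_assoc, e, add_mul, mul_assoc, ← pow_succ']
    exact add_mem
      (map_mul_mem_powFiltration hf _ (pow_mem_powFiltration _ (by lia)))
      (map_mul_mem_powFiltration hf _ (pow_mem_powFiltration _ (by lia)))

theorem pow_mul_mem_powFiltration_add (k : ℕ) {n : ℕ} {y : S} (hy : y ∈ powFiltration A x n) :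
    x ^ k * y ∈ powFiltration A x (n + k) := by
  induction k with
  | zero => simpa using hy
  | succ k ih =>
    rw [pow_succ', mul_assoc]
    exact mul_mem_powFiltration_succ hf hx ih

theorem mul_map_mem_powFiltration {n : ℕ} {y : S} (r : A) (hy : y ∈ powFiltration A x n) :
    y * f r ∈ powFiltration A x n := by
  refine powFiltration_induction hf (p := fun y => y * f r ∈ powFiltration A x n) (by simp)
    (fun y z hy hz => ?_) (fun r' i hi => ?_) hy
  · rw [add_mul]
    exact add_mem hy hz
  · have h : f r ∈ powFiltration A x 1 := by
      simpa using map_mul_mem_powFiltration hf r (pow_mem_powFiltration (A := A) x zero_lt_one)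
    rw [mul_assoc]
    exact map_mul_mem_powFiltration hf _
      (powFiltration_mono x (by lia) (pow_mul_mem_powFiltration_add hf hx i h))

theorem exists_map_mul_pow_sub_mem (n : ℕ) (r : A) :
    ∃ u, f r * x ^ n - x ^ n * f u ∈ powFiltration A x n := by
  induction n generalizing r with
  | zero => exact ⟨r, by simp⟩
  | succ n ih =>
    obtain ⟨u, v, e⟩ := hx.right r
    obtain ⟨w, hw⟩ := ih u
    refine ⟨w, ?_⟩
    have : f r * x ^ (n + 1) - x ^ (n + 1) * f w =
        x * (f u * x ^ n - x ^ n * f w) + f v * x ^ n := by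
      rw [pow_succ', ← mul_assoc, e]
      noncomm_ring
    rw [this]
    exact add_mem (mul_mem_powFiltration_succ hf hx hw)
      (map_mul_mem_powFiltration hf _ (pow_mem_powFiltration _ n.lt_succ_self))

theorem exists_pow_mul_map_sub_mem (n : ℕ) (r : A) :
    ∃ u, f u * x ^ n - x ^ n * f r ∈ powFiltration A x n := by
  induction n generalizing r with
  | zero => exact ⟨r, by simp⟩
  | succ n ih =>
    obtain ⟨w, hw⟩ := ih r
    obtain ⟨u, v, e⟩ := hx.left w
    refine ⟨u, ?_⟩
    have : f u * x ^ (n + 1) - x ^ (n + 1) * f r =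
        x * (f w * x ^ n - x ^ n * f r) - f v * x ^ n := by
      rw [mul_sub, ← mul_assoc x (f w), e]
      simp only [pow_succ', add_mul, mul_assoc]
      abel
    rw [this]
    exact sub_mem (mul_mem_powFiltration_succ hf hx hw)
      (map_mul_mem_powFiltration hf _ (pow_mem_powFiltration _ n.lt_succ_self))

theorem exists_sub_pow_mul_map_mem {n : ℕ} {y : S} (hy : y ∈ powFiltration A x (n + 1)) :
    ∃ r, y - x ^ n * f r ∈ powFiltration A x n := by
  refine powFiltration_induction hf (p := fun y => ∃ r, y - x ^ n * f r ∈ powFiltration A x n)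
    ⟨0, by simp⟩ ?_ (fun r i hi => ?_) hy
  · rintro y z ⟨r, hr⟩ ⟨r', hr'⟩
    refine ⟨r + r', ?_⟩
    rw [map_add, mul_add, add_sub_add_comm]
    exact add_mem hr hr'
  · rcases Nat.lt_succ_iff_lt_or_eq.mp hi with hi | rfl
    · refine ⟨0, ?_⟩
      simpa using map_mul_mem_powFiltration hf r (pow_mem_powFiltration x hi)
    · exact exists_map_mul_pow_sub_mem hf hx i r

theorem exists_mem_powFiltration
    (hgen : ∀ T : Subring S, f.range ≤ T → x ∈ T → T = ⊤) (y : S) :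
    ∃ n, y ∈ powFiltration A x n := by
  let T : Subring S :=
    { carrier := {y | ∀ n, ∀ z ∈ powFiltration A x n, ∃ m, y * z ∈ powFiltration A x m}
      mul_mem' := fun {a b} ha hb n z hz => by
        obtain ⟨m, hm⟩ := hb n z hz
        obtain ⟨k, hk⟩ := ha m _ hm
        exact ⟨k, by rwa [mul_assoc]⟩
      one_mem' := fun n z hz => ⟨n, by rwa [one_mul]⟩
      add_mem' := fun {a b} ha hb n z hz => by
        obtain ⟨m, hm⟩ := ha n z hz
        obtain ⟨k, hk⟩ := hb n z hz
        refine ⟨max m k, ?_⟩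
        rw [add_mul]
        exact add_mem (powFiltration_mono x (le_max_left _ _) hm)
          (powFiltration_mono x (le_max_right _ _) hk)
      zero_mem' := fun n z _ => ⟨n, by simp⟩
      neg_mem' := fun {a} ha n z hz => by
        obtain ⟨m, hm⟩ := ha n z hz
        exact ⟨m, by simpa using hm⟩ }
  have hT : T = ⊤ := by
    refine hgen T ?_ fun n z hz => ⟨n + 1, mul_mem_powFiltration_succ hf hx hz⟩
    rintro - ⟨r, rfl⟩ n z hz
    exact ⟨n, map_mul_mem_powFiltration hf r hz⟩
  have hy : y ∈ T := hT ▸ Subring.mem_top y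
  simpa using hy 1 1 (by simpa using pow_mem_powFiltration (A := A) x zero_lt_one)

/-- The left ideal of leading coefficients of degree `n` of a left ideal `I`. -/
def leadingCoeffIdeal (I : Ideal S) (n : ℕ) : Ideal A where
  carrier := {r | ∃ y ∈ I, y - x ^ n * f r ∈ powFiltration A x n}
  zero_mem' := ⟨0, I.zero_mem, by simp⟩
  add_mem' := by
    rintro r r' ⟨y, hy, h⟩ ⟨z, hz, h'⟩
    refine ⟨y + z, I.add_mem hy hz, ?_⟩
    rw [map_add, mul_add, add_sub_add_comm]
    exact add_mem h h'
  smul_mem' := by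
    rintro r' r ⟨y, hy, h⟩
    obtain ⟨u, hu⟩ := exists_pow_mul_map_sub_mem hf hx n r'
    refine ⟨f u * y, I.mul_mem_left _ hy, ?_⟩
    have : f u * y - x ^ n * f (r' • r) =
        f u * (y - x ^ n * f r) + (f u * x ^ n - x ^ n * f r') * f r := by
      rw [smul_eq_mul, map_mul]
      noncomm_ring
    rw [this]
    exact add_mem (map_mul_mem_powFiltration hf _ h) (mul_map_mem_powFiltration hf hx _ hu)

theorem leadingCoeffIdeal_mono (I : Ideal S) : Monotone (leadingCoeffIdeal hf hx I) := by
  refine monotone_nat_of_le_succ fun n => ?_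
  rintro r ⟨y, hy, h⟩
  refine ⟨x * y, I.mul_mem_left _ hy, ?_⟩
  rw [pow_succ', mul_assoc, ← mul_sub]
  exact mul_mem_powFiltration_succ hf hx h

end OreFiltration

/-- Hilbert's basis theorem for a ring generated by a left Noetherian ring `A` and an element `x`
with `x A + A = A x + A`. -/
theorem AlmostNormalizes.isNoetherianRing {A S : Type*} [Ring A] [Ring S] [IsNoetherianRing A]
    {f : A →+* S} {x : S} (hx : AlmostNormalizes f x)
    (hgen : ∀ T : Subring S, f.range ≤ T → x ∈ T → T = ⊤) : IsNoetherianRing S := by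
  let _ : Module A S := Module.compHom S f
  have hf : ∀ (r : A) (s : S), r • s = f r * s := fun _ _ => rfl
  refine ⟨fun (I : Ideal S) => ?_⟩
  obtain ⟨N, hN⟩ := monotone_stabilizes_iff_noetherian.mpr ‹IsNoetherianRing A›
    ⟨leadingCoeffIdeal hf hx I, leadingCoeffIdeal_mono hf hx I⟩
  let J : Submodule A S :=
    { I.toAddSubmonoid with smul_mem' := fun r y hy => I.mul_mem_left (f r) hy }
  have hnoeth := isNoetherian_of_fg_of_noetherian _ (powFiltration_fg (A := A) x (N + 1))
  obtain ⟨G, hG⟩ : (powFiltration A x (N + 1) ⊓ J).FG :=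
    (isNoetherian_submodule.mp hnoeth) _ inf_le_left
  have hGI : Ideal.span (G : Set S) ≤ I := by
    refine Ideal.span_le.mpr fun y hy => ?_
    have : y ∈ powFiltration A x (N + 1) ⊓ J := hG ▸ Submodule.subset_span hy
    exact this.2
  let K : Submodule A S :=
    { (Ideal.span (G : Set S)).toAddSubmonoid with
      smul_mem' := fun r y hy => (Ideal.span (G : Set S)).mul_mem_left (f r) hy }
  have hbase : ∀ y ∈ powFiltration A x (N + 1), y ∈ I → y ∈ Ideal.span (G : Set S) := by
    intro y hy hyI
    have hle : Submodule.span A (G : Set S) ≤ K :=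
      Submodule.span_le.mpr fun z hz => Ideal.subset_span hz
    exact hle (hG ▸ ⟨hy, hyI⟩)
  have hind : ∀ n, ∀ y ∈ powFiltration A x n, y ∈ I → y ∈ Ideal.span (G : Set S) := by
    intro n
    induction n with
    | zero => exact fun y hy => hbase y (powFiltration_mono x (Nat.zero_le _) hy)
    | succ n ih =>
      intro y hy hyI
      rcases le_total n N with hn | hn
      · exact hbase y (powFiltration_mono x (by lia) hy) hyI
      obtain ⟨r, hr⟩ := exists_sub_pow_mul_map_mem hf hx hy
      have hrn : r ∈ leadingCoeffIdeal hf hx I n := ⟨y, hyI, hr⟩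
      have hNn : leadingCoeffIdeal hf hx I N = leadingCoeffIdeal hf hx I n := hN n hn
      rw [← hNn] at hrn
      obtain ⟨z, hzI, hz⟩ := hrn
      obtain ⟨k, rfl⟩ := Nat.exists_eq_add_of_le hn
      have hzG : z ∈ Ideal.span (G : Set S) := by
        refine hbase z ?_ hzI
        have hlead : x ^ N * f r ∈ powFiltration A x (N + 1) :=
          mul_map_mem_powFiltration hf hx r (pow_mem_powFiltration x N.lt_succ_self)
        simpa using add_mem (powFiltration_mono x N.le_succ hz) hlead
      have hdiff : y - x ^ k * z ∈ powFiltration A x (N + k) := by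
        have : y - x ^ k * z = (y - x ^ (N + k) * f r) - x ^ k * (z - x ^ N * f r) := by
          rw [add_comm N k, pow_add]
          noncomm_ring
        rw [this]
        exact sub_mem hr (pow_mul_mem_powFiltration_add hf hx k hz)
      have := ih _ hdiff (I.sub_mem hyI (I.mul_mem_left _ hzI))
      simpa using add_mem this (Ideal.mul_mem_left _ (x ^ k) hzG)
  refine ⟨G, le_antisymm hGI fun y hy => ?_⟩
  obtain ⟨n, hn⟩ := exists_mem_powFiltration hf hx hgen y
  exact hind n y hn hy

theorem AlmostNormalizes.isNoetherianRing_op {A S : Type*} [Ring A] [Ring S]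
    [IsNoetherianRing Aᵐᵒᵖ] {f : A →+* S} {x : S} (hx : AlmostNormalizes f x)
    (hgen : ∀ T : Subring S, f.range ≤ T → x ∈ T → T = ⊤) : IsNoetherianRing Sᵐᵒᵖ := by
  refine hx.op.isNoetherianRing fun T hT hxT => ?_
  have h : T.unop = ⊤ := by
    refine hgen _ ?_ hxT
    rintro - ⟨r, rfl⟩
    exact hT ⟨.op r, rfl⟩
  refine eq_top_iff.mpr fun y _ => ?_
  have hy : y.unop ∈ T.unop := h ▸ Subring.mem_top _
  exact hy

section Adjoin

variable {R S : Type*} [CommRing R] [Ring S] [Algebra R S]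

theorem almostNormalizes_adjoin {G : Set S} {x : S}
    (hl : ∀ g ∈ G, ∃ u ∈ Algebra.adjoin R G, ∃ v ∈ Algebra.adjoin R G, x * g = u * x + v)
    (hr : ∀ g ∈ G, ∃ u ∈ Algebra.adjoin R G, ∃ v ∈ Algebra.adjoin R G, g * x = x * u + v)
    {B : Subalgebra R S} (hB : Algebra.adjoin R G ≤ B) (hx : x ∈ B) :
    AlmostNormalizes (Subalgebra.inclusion hB).toRingHom ⟨x, hx⟩ where
  left := by
    suffices ∀ r ∈ Algebra.adjoin R G, ∃ u ∈ Algebra.adjoin R G, ∃ v ∈ Algebra.adjoin R G,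
        x * r = u * x + v by
      rintro ⟨r, h⟩
      obtain ⟨u, hu, v, hv, e⟩ := this r h
      exact ⟨⟨u, hu⟩, ⟨v, hv⟩, Subtype.ext e⟩
    intro r h
    induction h using Algebra.adjoin_induction with
    | mem g hg => exact hl g hg
    | algebraMap r =>
      exact ⟨_, algebraMap_mem _ r, 0, zero_mem _, by rw [add_zero, Algebra.commutes]⟩
    | add y z _ _ hy hz =>
      obtain ⟨u, hu, v, hv, e⟩ := hy
      obtain ⟨u', hu', v', hv', e'⟩ := hz
      exact ⟨_, add_mem hu hu', _, add_mem hv hv', by rw [mul_add, e, e']; noncomm_ring⟩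
    | mul y z _ hzA hy hz =>
      obtain ⟨u, hu, v, hv, e⟩ := hy
      obtain ⟨u', hu', v', hv', e'⟩ := hz
      refine ⟨_, mul_mem hu hu', _, add_mem (mul_mem hu hv') (mul_mem hv hzA), ?_⟩
      rw [← mul_assoc, e, add_mul, mul_assoc, e']
      noncomm_ring
  right := by
    suffices ∀ r ∈ Algebra.adjoin R G, ∃ u ∈ Algebra.adjoin R G, ∃ v ∈ Algebra.adjoin R G,
        r * x = x * u + v by
      rintro ⟨r, h⟩
      obtain ⟨u, hu, v, hv, e⟩ := this r h
      exact ⟨⟨u, hu⟩, ⟨v, hv⟩, Subtype.ext e⟩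
    intro r h
    induction h using Algebra.adjoin_induction with
    | mem g hg => exact hr g hg
    | algebraMap r =>
      exact ⟨_, algebraMap_mem _ r, 0, zero_mem _, by rw [add_zero, Algebra.commutes]⟩
    | add y z _ _ hy hz =>
      obtain ⟨u, hu, v, hv, e⟩ := hy
      obtain ⟨u', hu', v', hv', e'⟩ := hz
      exact ⟨_, add_mem hu hu', _, add_mem hv hv', by rw [add_mul, e, e']; noncomm_ring⟩
    | mul y z hyA _ hy hz =>
      obtain ⟨u, hu, v, hv, e⟩ := hy
      obtain ⟨u', hu', v', hv', e'⟩ := hz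
      refine ⟨_, mul_mem hu hu', _, add_mem (mul_mem hv hu') (mul_mem hyA hv'), ?_⟩
      rw [mul_assoc, e', mul_add, ← mul_assoc, e]
      noncomm_ring

theorem isNoetherianRing_adjoin_insert {G : Set S} {x : S}
    (h : IsNoetherianRing (Algebra.adjoin R G) ∧ IsNoetherianRing (Algebra.adjoin R G)ᵐᵒᵖ)
    (hl : ∀ g ∈ G, ∃ u ∈ Algebra.adjoin R G, ∃ v ∈ Algebra.adjoin R G, x * g = u * x + v)
    (hr : ∀ g ∈ G, ∃ u ∈ Algebra.adjoin R G, ∃ v ∈ Algebra.adjoin R G, g * x = x * u + v) :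
    IsNoetherianRing (Algebra.adjoin R (insert x G)) ∧
      IsNoetherianRing (Algebra.adjoin R (insert x G))ᵐᵒᵖ := by
  obtain ⟨h₁, h₂⟩ := h
  have hle : Algebra.adjoin R G ≤ Algebra.adjoin R (insert x G) :=
    Algebra.adjoin_mono (Set.subset_insert x G)
  have hx : x ∈ Algebra.adjoin R (insert x G) := Algebra.subset_adjoin (Set.mem_insert x G)
  have hn := almostNormalizes_adjoin hl hr hle hx
  have hgen : ∀ T : Subring (Algebra.adjoin R (insert x G)),
      (Subalgebra.inclusion hle).toRingHom.range ≤ T → ⟨x, hx⟩ ∈ T → T = ⊤ := by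
    intro T hT hxT
    refine eq_top_iff.mpr ?_
    rintro ⟨y, hy⟩ -
    induction hy using Algebra.adjoin_induction with
    | mem g hg =>
      rcases hg with rfl | hg
      · exact hxT
      · exact hT ⟨⟨g, Algebra.subset_adjoin hg⟩, rfl⟩
    | algebraMap r => exact hT ⟨algebraMap R _ r, rfl⟩
    | add y z _ _ hy hz => exact add_mem hy hz
    | mul y z _ _ hy hz => exact mul_mem hy hz
  exact ⟨hn.isNoetherianRing hgen, hn.isNoetherianRing_op hgen⟩

theorem isNoetherianRing_adjoin_empty [IsNoetherianRing R] :
    IsNoetherianRing (Algebra.adjoin R (∅ : Set S)) ∧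
      IsNoetherianRing (Algebra.adjoin R (∅ : Set S))ᵐᵒᵖ := by
  have hsurj : Function.Surjective (algebraMap R (Algebra.adjoin R (∅ : Set S))) := by
    rintro ⟨y, hy⟩
    rw [Algebra.adjoin_empty] at hy
    obtain ⟨r, rfl⟩ := Algebra.mem_bot.mp hy
    exact ⟨r, rfl⟩
  refine ⟨isNoetherianRing_of_surjective _ _ _ hsurj, ?_⟩
  refine isNoetherianRing_of_surjective R _ (algebraMap R (Algebra.adjoin R (∅ : Set S))ᵐᵒᵖ) ?_
  intro y
  obtain ⟨r, hr⟩ := hsurj y.unop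
  exact ⟨r, MulOpposite.unop_injective hr⟩

end Adjoin

namespace QLoop

variable (s t : R)

/-- The canonical projection from the free algebra. -/
def mk : FreeAlgebra R (Fin 4) →ₐ[R] QLoop R s t := RingQuot.mkAlgHom R (LRel R s t)

theorem mk_eq {x y : FreeAlgebra R (Fin 4)} (h : LRel R s t x y) : mk R s t x = mk R s t y :=
  RingQuot.mkAlgHom_rel R h

theorem mk_gA : mk R s t (gA R) = qa R s t := rfl
theorem mk_gB : mk R s t (gB R) = qb R s t := rfl
theorem mk_gC : mk R s t (gC R) = qc R s t := rfl
theorem mk_gD : mk R s t (gD R) = qd R s t := rfl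

theorem mk_surjective : Function.Surjective (mk R s t) := RingQuot.mkAlgHom_surjective R _

theorem adjoin_eq_top :
    Algebra.adjoin R {qc R s t, qb R s t, qa R s t, qd R s t} = ⊤ := by
  have h := congrArg (Subalgebra.map (mk R s t)) (FreeAlgebra.adjoin_range_ι R (Fin 4))
  rw [Algebra.map_top, (AlgHom.range_eq_top _).mpr (mk_surjective R s t),
    AlgHom.map_adjoin] at h
  rw [← top_le_iff, ← h]
  refine Algebra.adjoin_mono ?_
  rintro - ⟨-, ⟨i, rfl⟩, rfl⟩
  fin_cases i
  · exact .inr (.inr (.inl rfl))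
  · exact .inr (.inl rfl)
  · exact .inl rfl
  · exact .inr (.inr (.inr rfl))

theorem a_mul_d : qa R s t * qd R s t = qd R s t * qa R s t := by
  simpa only [map_mul, mk_gA, mk_gD] using mk_eq R s t .rel1

theorem a_mul_b : qa R s t * qb R s t = qb R s t * (qa R s t - (1 - t) • qd R s t) := by
  have h : qa R s t * qb R s t - qb R s t * qa R s t =
      -(algebraMap R _ (1 - t) * (qb R s t * qd R s t)) := by
    simpa only [map_sub, map_mul, map_neg, AlgHom.commutes, mk_gA, mk_gB, mk_gC, mk_gD]
      using mk_eq R s t .rel2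
  rw [mul_sub, mul_smul_comm, Algebra.smul_def, eq_add_of_sub_eq h]
  abel

theorem d_mul_b : qd R s t * qb R s t = qb R s t * (s • qd R s t) := by
  rw [mul_smul_comm, Algebra.smul_def]
  simpa only [map_mul, AlgHom.commutes, mk_gA, mk_gB, mk_gC, mk_gD]
      using mk_eq R s t .rel3

theorem c_mul_b : qc R s t * qb R s t =
    qb R s t * qc R s t + (1 - t) • (qd R s t * qa R s t - qd R s t * qd R s t) := by
  rw [add_comm, ← sub_eq_iff_eq_add, Algebra.smul_def]
  simpa only [map_sub, map_mul, AlgHom.commutes, mk_gA, mk_gB, mk_gC, mk_gD]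
      using mk_eq R s t .rel4

theorem c_mul_d : qc R s t * qd R s t = (s • qd R s t) * qc R s t := by
  rw [smul_mul_assoc, Algebra.smul_def]
  simpa only [map_mul, AlgHom.commutes, mk_gA, mk_gB, mk_gC, mk_gD]
      using mk_eq R s t .rel5

theorem c_mul_a : qc R s t * qa R s t = (qa R s t - (1 - t) • qd R s t) * qc R s t := by
  have h : qa R s t * qc R s t - qc R s t * qa R s t =
      algebraMap R _ (1 - t) * (qd R s t * qc R s t) := by
    simpa only [map_sub, map_mul, AlgHom.commutes, mk_gA, mk_gB, mk_gC, mk_gD]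
      using mk_eq R s t .rel6
  rw [sub_mul, smul_mul_assoc, Algebra.smul_def, ← h]
  abel

variable {s t}

theorem b_mul_d (hst : s * t = 1) : qb R s t * qd R s t = (t • qd R s t) * qb R s t := by
  rw [smul_mul_assoc, d_mul_b, mul_smul_comm, smul_smul, mul_comm t, hst, one_smul]

theorem d_mul_c (hst : s * t = 1) : qd R s t * qc R s t = qc R s t * (t • qd R s t) := by
  rw [mul_smul_comm, c_mul_d, smul_mul_assoc, smul_smul, mul_comm t, hst, one_smul]

theorem b_mul_a (hst : s * t = 1) :
    qb R s t * qa R s t = (qa R s t + ((1 - t) * t) • qd R s t) * qb R s t := by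
  rw [add_mul, a_mul_b, mul_smul, smul_mul_assoc, ← b_mul_d R hst, mul_sub, mul_smul_comm]
  abel

theorem a_mul_c (hst : s * t = 1) :
    qa R s t * qc R s t = qc R s t * (qa R s t + ((1 - t) * t) • qd R s t) := by
  rw [mul_add, c_mul_a, mul_smul, mul_smul_comm, ← d_mul_c R hst, sub_mul, smul_mul_assoc]
  abel

variable (s t)

theorem isNoetherianRing_and_op [IsNoetherianRing R] (hst : s * t = 1) :
    IsNoetherianRing (QLoop R s t) ∧ IsNoetherianRing (QLoop R s t)ᵐᵒᵖ := by
  have hd := isNoetherianRing_adjoin_insert (R := R) (x := qd R s t)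
    isNoetherianRing_adjoin_empty (by simp) (by simp)
  have ha := isNoetherianRing_adjoin_insert (x := qa R s t) hd
    (by
      rintro g (rfl | hg)
      · exact ⟨_, Algebra.subset_adjoin (.inl rfl), 0, zero_mem _, by rw [a_mul_d, add_zero]⟩
      · exact hg.elim)
    (by
      rintro g (rfl | hg)
      · exact ⟨_, Algebra.subset_adjoin (.inl rfl), 0, zero_mem _, by rw [a_mul_d, add_zero]⟩
      · exact hg.elim)
  rw [insert_empty_eq] at ha
  have haA : qa R s t ∈ Algebra.adjoin R {qa R s t, qd R s t} :=
    Algebra.subset_adjoin (.inl rfl)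
  have hdA : qd R s t ∈ Algebra.adjoin R {qa R s t, qd R s t} :=
    Algebra.subset_adjoin (.inr rfl)
  have hb := isNoetherianRing_adjoin_insert (x := qb R s t) ha
    (by
      rintro g (rfl | rfl)
      · exact ⟨_, add_mem haA (Subalgebra.smul_mem _ hdA _), 0, zero_mem _,
          by rw [b_mul_a R hst, add_zero]⟩
      · exact ⟨_, Subalgebra.smul_mem _ hdA t, 0, zero_mem _, by rw [b_mul_d R hst, add_zero]⟩)
    (by
      rintro g (rfl | rfl)
      · exact ⟨_, sub_mem haA (Subalgebra.smul_mem _ hdA _), 0, zero_mem _,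
          by rw [a_mul_b, add_zero]⟩
      · exact ⟨_, Subalgebra.smul_mem _ hdA s, 0, zero_mem _, by rw [d_mul_b, add_zero]⟩)
  have hle := Algebra.adjoin_mono (R := R) (Set.subset_insert (qb R s t) {qa R s t, qd R s t})
  replace haA := hle haA
  replace hdA := hle hdA
  have hbA : qb R s t ∈ Algebra.adjoin R {qb R s t, qa R s t, qd R s t} :=
    Algebra.subset_adjoin (.inl rfl)
  have hcomm := Subalgebra.smul_mem _ (sub_mem (mul_mem hdA haA) (mul_mem hdA hdA)) (1 - t)
  have hc := isNoetherianRing_adjoin_insert (x := qc R s t) hb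
    (by
      rintro g (rfl | rfl | rfl)
      · exact ⟨_, hbA, _, hcomm, c_mul_b R s t⟩
      · exact ⟨_, sub_mem haA (Subalgebra.smul_mem _ hdA _), 0, zero_mem _,
          by rw [c_mul_a, add_zero]⟩
      · exact ⟨_, Subalgebra.smul_mem _ hdA s, 0, zero_mem _, by rw [c_mul_d, add_zero]⟩)
    (by
      rintro g (rfl | rfl | rfl)
      · exact ⟨_, hbA, _, neg_mem hcomm, by rw [c_mul_b]; abel⟩
      · exact ⟨_, add_mem haA (Subalgebra.smul_mem _ hdA _), 0, zero_mem _,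
          by rw [a_mul_c R hst, add_zero]⟩
      · exact ⟨_, Subalgebra.smul_mem _ hdA t, 0, zero_mem _, by rw [d_mul_c R hst, add_zero]⟩)
  rw [adjoin_eq_top] at hc
  let e : (⊤ : Subalgebra R (QLoop R s t)) ≃+* QLoop R s t := Subalgebra.topEquiv.toRingEquiv
  obtain ⟨h₁, h₂⟩ := hc
  exact ⟨isNoetherianRing_of_ringEquiv _ e, isNoetherianRing_of_ringEquiv _ (RingEquiv.op e)⟩

end QLoop

/-- The ℂ[q,q⁻¹]-algebra 𝓛^A is left and right Noetherian, and for every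
`q₀ ∈ ℂ \ {0, 1}` the ℂ-algebra 𝓛(q₀) is left and right Noetherian (right Noetherianity is
expressed as left Noetherianity of the opposite ring). -/
theorem stmt_4 :
    (IsNoetherianRing LA ∧ IsNoetherianRing LAᵐᵒᵖ) ∧
    ∀ q₀ : ℂ, q₀ ≠ 0 → q₀ ≠ 1 →
      IsNoetherianRing (Lspec q₀) ∧ IsNoetherianRing (Lspec q₀)ᵐᵒᵖ := by
  refine ⟨?_, fun q₀ h₀ _ => ?_⟩
  · have : IsNoetherianRing (LaurentPolynomial ℂ) :=
      IsLocalization.isNoetherianRing (Submonoid.powers (Polynomial.X : Polynomial ℂ)) _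
        inferInstance
    refine QLoop.isNoetherianRing_and_op _ _ _ ?_
    rw [← LaurentPolynomial.T_add]
    simp
  · exact QLoop.isNoetherianRing_and_op _ _ _ (mul_inv_cancel₀ (pow_ne_zero 2 h₀))

end
end

section
/- Let φ : ℂ[W,X,Y,T] → 𝓛(ε) be the ℂ-algebra homomorphism from the commutative polynomial ring in four variables determined by φ(W) = ω, φ(X) = b^l, φ(Y) = c^l, φ(T) = d^l. Then the image of φ is exactly the center of 𝓛(ε), and the kernel of φ is the ideal of ℂ[W,X,Y,T] generated by the single polynomial (T_l(W) − T)·T − X·Y − 1. -/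
set_option synthInstance.maxHeartbeats 1000000

noncomputable section

variable (R : Type*) [CommRing R]

/-- The generators a, b, c, d of 𝓛(q₀). -/
def la (q₀ : ℂ) : Lspec q₀ := qa ℂ (q₀ ^ 2) ((q₀ ^ 2)⁻¹)
def lb (q₀ : ℂ) : Lspec q₀ := qb ℂ (q₀ ^ 2) ((q₀ ^ 2)⁻¹)
def lc (q₀ : ℂ) : Lspec q₀ := qc ℂ (q₀ ^ 2) ((q₀ ^ 2)⁻¹)
def ld (q₀ : ℂ) : Lspec q₀ := qd ℂ (q₀ ^ 2) ((q₀ ^ 2)⁻¹)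

/-- The central element ω := q₀·a + q₀⁻¹·d of 𝓛(q₀). -/
def omegaL (q₀ : ℂ) : Lspec q₀ :=
  algebraMap ℂ (Lspec q₀) q₀ * la q₀ + algebraMap ℂ (Lspec q₀) q₀⁻¹ * ld q₀

open Polynomial

/-- Integer powers for a pair of elements: `b ^ n` for `n ≥ 0` and `c ^ (-n)` for `n < 0`. -/
def weylPow {A : Type*} [Ring A] (b c : A) : ℤ → A
  | Int.ofNat k => b ^ k
  | Int.negSucc k => c ^ (k + 1)

section NormalForm

variable {K A : Type*} [CommRing K] [Ring A]

lemma map_weylPow {A' : Type*} [Ring A'] (f : A →+* A') (b c : A) (n : ℤ) :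
    f (weylPow b c n) = weylPow (f b) (f c) n := by
  cases n <;> simp [weylPow]

lemma weylPow_pow (b c : A) (l : ℕ) (hl : l ≠ 0) (n : ℤ) :
    weylPow (b ^ l) (c ^ l) n = weylPow b c (l * n) := by
  obtain ⟨l, rfl⟩ := Nat.exists_eq_succ_of_ne_zero hl
  cases n with
  | ofNat k =>
    have : ((l.succ : ℕ) : ℤ) * Int.ofNat k = Int.ofNat (l.succ * k) := by simp
    rw [this]; simp [weylPow, pow_mul]
  | negSucc k =>
    have : ((l.succ : ℕ) : ℤ) * Int.negSucc k = Int.negSucc (l.succ * k + l) := by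
      rw [Int.negSucc_eq, Int.negSucc_eq]; push_cast; ring
    rw [this]; simp only [weylPow, ← pow_mul]; congr 1

/-- The additive map `h ↦ ∑ n, ι (h n) * weylPow b c n`. -/
def weylSum (ι : K →+* A) (b c : A) : (ℤ →₀ K) →+ A :=
  Finsupp.liftAddHom fun n => (AddMonoidHom.mulRight (weylPow b c n)).comp ι.toAddMonoidHom

lemma weylSum_single (ι : K →+* A) (b c : A) (n : ℤ) (f : K) :
    weylSum ι b c (Finsupp.single n f) = ι f * weylPow b c n := by
  simp [weylSum]

lemma weylSum_apply (ι : K →+* A) (b c : A) (h : ℤ →₀ K) :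
    weylSum ι b c h = ∑ n ∈ h.support, ι (h n) * weylPow b c n := by
  simp [weylSum, Finsupp.sum]

/-- Elements of a generalized Weyl algebra have a normal form. -/
theorem mem_range_weylSum (ι : K →+* A) (σ σ' : K →+* K) (F F' : K) (b c : A)
    (hb : ∀ f, b * ι f = ι (σ f) * b) (hc : ∀ f, c * ι f = ι (σ' f) * c)
    (hcb : c * b = ι F) (hbc : b * c = ι F')
    (x : A) (hx : x ∈ Subring.closure (Set.range ι ∪ {b, c})) :
    x ∈ (weylSum ι b c).range := by
  have hbp : ∀ n, ∃ r, b * weylPow b c n = ι r * weylPow b c (n + 1) := by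
    rintro (k | k)
    · refine ⟨1, ?_⟩
      have : Int.ofNat k + 1 = Int.ofNat (k + 1) := by simp
      rw [this]; simp [weylPow, pow_succ']
    · refine ⟨F', ?_⟩
      have : weylPow b c (Int.negSucc k + 1) = c ^ k := by
        cases k with
        | zero => simp [weylPow]
        | succ k =>
          rw [show Int.negSucc (k + 1) + 1 = Int.negSucc k by
            rw [Int.negSucc_eq, Int.negSucc_eq]; push_cast; ring]
          simp [weylPow]
      rw [this]; simp [weylPow, pow_succ', ← mul_assoc, hbc]
  have hcp : ∀ n, ∃ r, c * weylPow b c n = ι r * weylPow b c (n - 1) := by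
    rintro ((_ | k) | k)
    · refine ⟨1, ?_⟩
      rw [show Int.ofNat 0 - 1 = Int.negSucc 0 from rfl]; simp [weylPow]
    · refine ⟨F, ?_⟩
      rw [show Int.ofNat (k + 1) - 1 = Int.ofNat k by simp]
      simp [weylPow, pow_succ', ← mul_assoc, hcb]
    · refine ⟨1, ?_⟩
      rw [show Int.negSucc k - 1 = Int.negSucc (k + 1) by
            rw [Int.negSucc_eq, Int.negSucc_eq]; push_cast; ring]
      simp [weylPow, pow_succ']
  have key : ∀ y ∈ (weylSum ι b c).range, x * y ∈ (weylSum ι b c).range := by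
    induction hx using Subring.closure_induction with
    | mem g hg =>
      rintro _ ⟨h, rfl⟩
      induction h using Finsupp.induction_linear with
      | zero => simp
      | add h₁ h₂ ih₁ ih₂ => rw [map_add, mul_add]; exact add_mem ih₁ ih₂
      | single n f =>
        rw [weylSum_single]
        rcases hg with ⟨f', rfl⟩ | rfl | rfl
        · exact ⟨Finsupp.single n (f' * f), by rw [weylSum_single, map_mul, mul_assoc]⟩
        · obtain ⟨r, hr⟩ := hbp n
          exact ⟨Finsupp.single (n + 1) (σ f * r), by
            rw [weylSum_single, map_mul, mul_assoc, ← hr, ← mul_assoc, ← hb, mul_assoc]⟩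
        · obtain ⟨r, hr⟩ := hcp n
          exact ⟨Finsupp.single (n - 1) (σ' f * r), by
            rw [weylSum_single, map_mul, mul_assoc, ← hr, ← mul_assoc, ← hc, mul_assoc]⟩
    | zero => intro y _; simp
    | one => intro y hy; simpa using hy
    | add u v _ _ hu hv => intro y hy; rw [add_mul]; exact add_mem (hu y hy) (hv y hy)
    | neg u _ hu => intro y hy; rw [neg_mul]; exact neg_mem (hu y hy)
    | mul u v _ _ hu hv => intro y hy; rw [mul_assoc]; exact hu _ (hv y hy)
  have h1 : (1 : A) ∈ (weylSum ι b c).range :=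
    ⟨Finsupp.single 0 1, by
      rw [weylSum_single, map_one, one_mul]; exact pow_zero b⟩
  simpa using key 1 h1

end NormalForm

/-- The substitution `d ↦ z * d` on `ℂ[ω][d]`. -/
def scaleVar (z : ℂ) : ℂ[X][X] →ₐ[ℂ[X]] ℂ[X][X] := aeval (C (C z) * X)

lemma scaleVar_X (z : ℂ) : scaleVar z X = C (C z) * X := by simp [scaleVar]

lemma scaleVar_C (z : ℂ) (f : ℂ[X]) : scaleVar z (C f) = C f := by simp [scaleVar]

lemma coeff_scaleVar (z : ℂ) (f : ℂ[X][X]) (n : ℕ) :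
    (scaleVar z f).coeff n = f.coeff n * C z ^ n := by
  simp only [scaleVar]
  rw [← comp_eq_aeval, comp_C_mul_X_coeff]

lemma scaleVar_scaleVar (y z : ℂ) (f : ℂ[X][X]) :
    scaleVar y (scaleVar z f) = scaleVar (y * z) f := by
  ext n : 1
  simp only [coeff_scaleVar, C_mul]; ring

lemma scaleVar_one (f : ℂ[X][X]) : scaleVar 1 f = f := by
  ext n : 1
  simp [coeff_scaleVar]

lemma scaleVar_smul (z r : ℂ) (f : ℂ[X][X]) : scaleVar z (r • f) = r • scaleVar z f := by
  ext n : 1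
  simp [coeff_scaleVar]

/-- The element of `ℂ[ω][d]` representing the product `c * b`. -/
def weylPoly (q : ℂ) : ℂ[X][X] := C (C q⁻¹ * X) * X - X ^ 2 - C (C (q ^ 2)⁻¹)

lemma weylPoly_ne_zero (q : ℂ) : weylPoly q ≠ 0 := by
  intro h
  have := congrArg (fun f => f.coeff 2) h
  simp [weylPoly] at this

section Relations

variable (q : ℂ)

/-- The quotient map onto `Lspec q`. -/
def mkLspec : FreeAlgebra ℂ (Fin 4) →ₐ[ℂ] Lspec q :=
  RingQuot.mkAlgHom ℂ (LRel ℂ (q ^ 2) ((q ^ 2)⁻¹))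

lemma mkLspec_rel {x y : FreeAlgebra ℂ (Fin 4)} (h : LRel ℂ (q ^ 2) ((q ^ 2)⁻¹) x y) :
    mkLspec q x = mkLspec q y :=
  RingQuot.mkAlgHom_rel ℂ h

lemma mkLspec_surjective : Function.Surjective (mkLspec q) :=
  RingQuot.mkAlgHom_surjective ℂ _

lemma la_mul_ld : la q * ld q = ld q * la q := by
  have := mkLspec_rel q LRel.rel1
  simp only [map_mul] at this
  exact this

lemma la_mul_lb : la q * lb q = lb q * la q - (1 - (q ^ 2)⁻¹) • (lb q * ld q) := by
  have := mkLspec_rel q LRel.rel2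
  simp only [← Algebra.smul_def, map_mul, map_neg, map_sub (mkLspec q), map_smul] at this
  exact (sub_eq_iff_eq_add'.1 this).trans (sub_eq_add_neg _ _).symm

lemma ld_mul_lb : ld q * lb q = q ^ 2 • (lb q * ld q) := by
  have := mkLspec_rel q LRel.rel3
  simp only [← Algebra.smul_def, map_mul, map_smul] at this
  exact this

lemma lc_mul_lb : lc q * lb q =
    lb q * lc q + (1 - (q ^ 2)⁻¹) • (ld q * la q - ld q * ld q) := by
  have := mkLspec_rel q LRel.rel4
  simp only [← Algebra.smul_def, map_mul, map_sub (mkLspec q), map_smul] at this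
  exact (sub_eq_iff_eq_add'.1 this)

lemma lc_mul_ld : lc q * ld q = q ^ 2 • (ld q * lc q) := by
  have := mkLspec_rel q LRel.rel5
  simp only [← Algebra.smul_def, map_mul, map_smul] at this
  exact this

lemma la_mul_lc : la q * lc q = lc q * la q + (1 - (q ^ 2)⁻¹) • (ld q * lc q) := by
  have := mkLspec_rel q LRel.rel6
  simp only [← Algebra.smul_def, map_mul, map_sub (mkLspec q), map_smul] at this
  exact (sub_eq_iff_eq_add'.1 this)

lemma la_mul_ld_eq : la q * ld q = q ^ 2 • (lb q * lc q) + 1 := by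
  have := mkLspec_rel q LRel.rel7
  simp only [← Algebra.smul_def, map_mul, map_sub (mkLspec q), map_smul, map_one] at this
  exact (sub_eq_iff_eq_add'.1 this)

lemma omegaL_eq : omegaL q = q • la q + q⁻¹ • ld q := by
  simp only [omegaL, Algebra.smul_def]

lemma Lspec_adjoin : Algebra.adjoin ℂ {la q, lb q, lc q, ld q} = ⊤ := by
  rw [eq_top_iff]
  rintro x -
  obtain ⟨y, rfl⟩ := mkLspec_surjective q x
  induction y using FreeAlgebra.induction with
  | grade0 r =>
    rw [AlgHom.commutes]
    exact Subalgebra.algebraMap_mem _ r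
  | grade1 i =>
    apply Algebra.subset_adjoin
    fin_cases i
    · exact Or.inl rfl
    · exact Or.inr (Or.inl rfl)
    · exact Or.inr (Or.inr (Or.inl rfl))
    · exact Or.inr (Or.inr (Or.inr rfl))
  | mul x y hx hy => rw [map_mul]; exact mul_mem hx hy
  | add x y hx hy => rw [map_add]; exact add_mem hx hy

variable {q}

/-- An element of `Lspec q` commuting with the generators is central. -/
lemma mem_center_of_commute {x : Lspec q} (ha : Commute x (la q)) (hb : Commute x (lb q))
    (hc : Commute x (lc q)) (hd : Commute x (ld q)) : x ∈ Subalgebra.center ℂ (Lspec q) := by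
  rw [Subalgebra.mem_center_iff]
  intro y
  have hy : y ∈ Algebra.adjoin ℂ {la q, lb q, lc q, ld q} := by rw [Lspec_adjoin]; trivial
  have hle : Algebra.adjoin ℂ {la q, lb q, lc q, ld q} ≤ Subalgebra.centralizer ℂ {x} := by
    rw [Algebra.adjoin_le_iff]
    rintro z (rfl | rfl | rfl | rfl) w rfl
    exacts [ha, hb, hc, hd]
  exact (hle hy x rfl).symm

variable (hq : q ≠ 0)
include hq

lemma omegaL_mem_center : omegaL q ∈ Subalgebra.center ℂ (Lspec q) := by
  apply mem_center_of_commute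
  · simp only [Commute, SemiconjBy, omegaL_eq, add_mul, mul_add, smul_mul_assoc, mul_smul_comm,
      la_mul_ld]
  · simp only [Commute, SemiconjBy, omegaL_eq, add_mul, mul_add, smul_mul_assoc, mul_smul_comm,
      la_mul_lb, ld_mul_lb]
    match_scalars <;> field_simp
    ring
  · simp only [Commute, SemiconjBy, omegaL_eq, add_mul, mul_add, smul_mul_assoc, mul_smul_comm,
      la_mul_lc, lc_mul_ld]
    match_scalars <;> field_simp
    ring
  · simp only [Commute, SemiconjBy, omegaL_eq, add_mul, mul_add, smul_mul_assoc, mul_smul_comm,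
      la_mul_ld]

lemma aeval_omegaL_mem_center (f : ℂ[X]) :
    aeval (omegaL q) f ∈ Subalgebra.center ℂ (Lspec q) :=
  Algebra.adjoin_le (Set.singleton_subset_iff.2 (omegaL_mem_center hq))
    (aeval_mem_adjoin_singleton ℂ (omegaL q))

lemma la_eq : la q = q⁻¹ • omegaL q - (q ^ 2)⁻¹ • ld q := by
  rw [omegaL_eq]
  match_scalars <;> field_simp
  ring

lemma mem_center_of_commute_lb_lc_ld {x : Lspec q} (hb : Commute x (lb q))
    (hc : Commute x (lc q)) (hd : Commute x (ld q)) : x ∈ Subalgebra.center ℂ (Lspec q) := by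
  refine mem_center_of_commute ?_ hb hc hd
  have hω : Commute x (omegaL q) := Subalgebra.mem_center_iff.1 (omegaL_mem_center hq) x
  rw [la_eq hq]
  exact (hω.smul_right _).sub_right (hd.smul_right _)

lemma lb_mul_ld : lb q * ld q = (q ^ 2)⁻¹ • (ld q * lb q) := by
  rw [ld_mul_lb, smul_smul, inv_mul_cancel₀ (pow_ne_zero 2 hq), one_smul]

lemma lb_mul_lc : lb q * lc q =
    (q ^ 2)⁻¹ • (q⁻¹ • (omegaL q * ld q) - (q ^ 2)⁻¹ • (ld q * ld q) - 1) := by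
  have h := la_mul_ld_eq q
  have h2 : lb q * lc q = (q ^ 2)⁻¹ • (la q * ld q - 1) := by
    rw [h, add_sub_cancel_right, smul_smul, inv_mul_cancel₀ (pow_ne_zero 2 hq), one_smul]
  rw [h2, la_eq hq, sub_mul, smul_mul_assoc, smul_mul_assoc]

lemma lc_mul_lb_eq : lc q * lb q =
    q⁻¹ • (omegaL q * ld q) - ld q * ld q - (q ^ 2)⁻¹ • (1 : Lspec q) := by
  rw [lc_mul_lb, ← la_mul_ld, lb_mul_lc hq, la_eq hq, sub_mul, smul_mul_assoc, smul_mul_assoc]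
  match_scalars <;> field_simp <;> ring

end Relations

section Embedding

/-- The embedding of `ℂ[ω][d]` into `Lspec q`. -/
def iotaL {q : ℂ} (hq : q ≠ 0) : ℂ[X][X] →+* Lspec q :=
  eval₂RingHom' (aeval (omegaL q) : ℂ[X] →ₐ[ℂ] Lspec q).toRingHom (ld q) fun f =>
    (Subalgebra.mem_center_iff.1 (aeval_omegaL_mem_center hq f) (ld q)).symm

variable {q : ℂ} (hq : q ≠ 0)

lemma iotaL_X : iotaL hq X = ld q := by simp [iotaL]

lemma iotaL_C (f : ℂ[X]) : iotaL hq (C f) = aeval (omegaL q) f := by simp [iotaL]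

lemma iotaL_C_C (z : ℂ) : iotaL hq (C (C z)) = algebraMap ℂ _ z := by
  rw [iotaL_C, aeval_C]

lemma iotaL_C_mem_center (f : ℂ[X]) : iotaL hq (C f) ∈ Subalgebra.center ℂ (Lspec q) := by
  rw [iotaL_C]
  exact aeval_omegaL_mem_center hq f

lemma mul_iotaL {x : Lspec q} {z : ℂ} (hx : x * ld q = z • (ld q * x)) (f : ℂ[X][X]) :
    x * iotaL hq f = iotaL hq (scaleVar z f) * x := by
  induction f using Polynomial.induction_on with
  | C a => rw [scaleVar_C]; exact Subalgebra.mem_center_iff.1 (iotaL_C_mem_center hq a) x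
  | add f g hf hg => simp only [map_add, mul_add, add_mul, hf, hg]
  | monomial n a ih =>
    rw [pow_succ, ← mul_assoc, map_mul, ← mul_assoc, ih, map_mul (scaleVar z) _ X, scaleVar_X,
      map_mul (iotaL hq), map_mul (iotaL hq) (C _), iotaL_C_C, iotaL_X, mul_assoc, mul_assoc,
      hx, ← Algebra.smul_def, smul_mul_assoc]

lemma lb_mul_iotaL (f : ℂ[X][X]) :
    lb q * iotaL hq f = iotaL hq (scaleVar (q ^ 2)⁻¹ f) * lb q :=
  mul_iotaL hq (lb_mul_ld hq) f

lemma lc_mul_iotaL (f : ℂ[X][X]) :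
    lc q * iotaL hq f = iotaL hq (scaleVar (q ^ 2) f) * lc q :=
  mul_iotaL hq (lc_mul_ld q) f

lemma lc_mul_lb_iotaL : lc q * lb q = iotaL hq (weylPoly q) := by
  rw [lc_mul_lb_eq hq, weylPoly]
  simp only [map_sub, map_mul, map_pow, iotaL_C, iotaL_X, aeval_C, aeval_X,
    Algebra.algebraMap_eq_smul_one, sq (ld q), smul_mul_assoc, one_mul]

lemma lb_mul_lc_iotaL : lb q * lc q = iotaL hq (scaleVar (q ^ 2)⁻¹ (weylPoly q)) := by
  rw [lb_mul_lc hq, weylPoly]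
  simp only [map_sub, map_mul, map_pow, scaleVar_C, scaleVar_X, iotaL_C, iotaL_X, aeval_C, aeval_X,
    Algebra.algebraMap_eq_smul_one, smul_mul_assoc, one_mul, _root_.smul_pow,
    mul_smul_comm, ← sq]
  match_scalars <;> field_simp

lemma lb_pow_mul_iotaL (k : ℕ) (f : ℂ[X][X]) :
    lb q ^ k * iotaL hq f = iotaL hq (scaleVar ((q ^ 2)⁻¹ ^ k) f) * lb q ^ k := by
  induction k generalizing f with
  | zero => simp [scaleVar_one]
  | succ k ih =>
    rw [pow_succ, mul_assoc, lb_mul_iotaL, ← mul_assoc, ih, scaleVar_scaleVar, mul_assoc,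
      ← pow_succ, ← pow_succ]

lemma lc_pow_mul_iotaL (k : ℕ) (f : ℂ[X][X]) :
    lc q ^ k * iotaL hq f = iotaL hq (scaleVar ((q ^ 2) ^ k) f) * lc q ^ k := by
  induction k generalizing f with
  | zero => simp [scaleVar_one]
  | succ k ih =>
    rw [pow_succ, mul_assoc, lc_mul_iotaL, ← mul_assoc, ih, scaleVar_scaleVar, mul_assoc,
      ← pow_succ, ← pow_succ]

lemma lc_pow_mul_lb_pow (k : ℕ) : lc q ^ k * lb q ^ k =
    iotaL hq (∏ j ∈ Finset.range k, scaleVar ((q ^ 2) ^ j) (weylPoly q)) := by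
  induction k with
  | zero => simp
  | succ k ih =>
    rw [pow_succ', pow_succ, mul_assoc, ← mul_assoc (lc q ^ k), ih, ← mul_assoc, lc_mul_iotaL,
      mul_assoc, lc_mul_lb_iotaL hq, ← map_mul, map_prod, Finset.prod_range_succ', pow_zero,
      scaleVar_one]
    simp only [scaleVar_scaleVar, ← pow_succ']

/-- Every element of `Lspec q` has a normal form. -/
lemma weylSum_iotaL_surjective (x : Lspec q) :
    ∃ h, weylSum (iotaL hq) (lb q) (lc q) h = x := by
  refine mem_range_weylSum (iotaL hq) (scaleVar (q ^ 2)⁻¹).toRingHom (scaleVar (q ^ 2)).toRingHom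
    _ _ (lb q) (lc q) (lb_mul_iotaL hq) (lc_mul_iotaL hq) (lc_mul_lb_iotaL hq)
    (lb_mul_lc_iotaL hq) x ?_
  have hx : x ∈ Algebra.adjoin ℂ {la q, lb q, lc q, ld q} := by rw [Lspec_adjoin]; trivial
  have hd : ld q ∈ Subring.closure (Set.range (iotaL hq) ∪ {lb q, lc q}) :=
    Subring.subset_closure (Or.inl ⟨X, iotaL_X hq⟩)
  have hs (z : ℂ) : algebraMap ℂ _ z ∈ Subring.closure (Set.range (iotaL hq) ∪ {lb q, lc q}) :=
    Subring.subset_closure (Or.inl ⟨_, iotaL_C_C hq z⟩)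
  induction hx using Algebra.adjoin_induction with
  | mem y hy =>
    rcases hy with rfl | rfl | rfl | rfl
    · rw [la_eq hq, Algebra.smul_def, Algebra.smul_def]
      refine sub_mem (mul_mem (hs _) (Subring.subset_closure (Or.inl ⟨C X, ?_⟩)))
        (mul_mem (hs _) hd)
      rw [iotaL_C, aeval_X]
    · exact Subring.subset_closure (Or.inr (Or.inl rfl))
    · exact Subring.subset_closure (Or.inr (Or.inr rfl))
    · exact hd
  | algebraMap z => exact hs z
  | add y z _ _ hy hz => exact add_mem hy hz
  | mul y z _ _ hy hz => exact mul_mem hy hz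

end Embedding

section Representation

variable (q : ℂ)

/-- Multiplication by `f`, as an operator on the skew Laurent series `∑ n, h n * b ^ n`. -/
def mulOp (f : ℂ[X][X]) : Module.End ℂ (ℤ → ℂ[X][X]) where
  toFun h n := f * h n
  map_add' h k := by ext n : 1; simp [mul_add]
  map_smul' r h := by ext n : 1; simp

/-- The operator `∑ n, h n * b ^ n ↦ ∑ n, (scaleVar z (h n)) * b ^ (n + k)`. -/
def shiftOp (z : ℂ) (k : ℤ) : Module.End ℂ (ℤ → ℂ[X][X]) where
  toFun h n := scaleVar z (h (n - k))
  map_add' h k := by ext n : 1; simp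
  map_smul' r h := by ext n : 1; simp [scaleVar_smul]

lemma mulOp_apply (f : ℂ[X][X]) (h : ℤ → ℂ[X][X]) (n : ℤ) : mulOp f h n = f * h n := rfl

lemma shiftOp_apply (z : ℂ) (k : ℤ) (h : ℤ → ℂ[X][X]) (n : ℤ) :
    shiftOp z k h n = scaleVar z (h (n - k)) := rfl

/-- Right multiplication by `d`, when `b * d = z * d * b`. -/
def twistOp (z : ℂ) : Module.End ℂ (ℤ → ℂ[X][X]) where
  toFun h n := C (C (z ^ n)) * X * h n
  map_add' h k := by ext n : 1; simp [mul_add]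
  map_smul' r h := by ext n : 1; simp

lemma twistOp_apply (z : ℂ) (h : ℤ → ℂ[X][X]) (n : ℤ) :
    twistOp z h n = C (C (z ^ n)) * X * h n := rfl

/-- The action of the free algebra on skew Laurent series. -/
def freeRep : FreeAlgebra ℂ (Fin 4) →ₐ[ℂ] Module.End ℂ (ℤ → ℂ[X][X]) :=
  FreeAlgebra.lift ℂ
    ![mulOp (C (C q⁻¹ * X) - C (C (q ^ 2)⁻¹) * X), shiftOp (q ^ 2)⁻¹ 1,
      mulOp (weylPoly q) * shiftOp (q ^ 2) (-1), mulOp X]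

lemma freeRep_gA : freeRep q (gA ℂ) = mulOp (C (C q⁻¹ * X) - C (C (q ^ 2)⁻¹) * X) := by
  simp [freeRep, gA]

lemma freeRep_gB : freeRep q (gB ℂ) = shiftOp (q ^ 2)⁻¹ 1 := by
  simp [freeRep, gB]

lemma freeRep_gC : freeRep q (gC ℂ) = mulOp (weylPoly q) * shiftOp (q ^ 2) (-1) := by
  simp [freeRep, gC]

lemma freeRep_gD : freeRep q (gD ℂ) = mulOp X := by
  simp [freeRep, gD]

variable {q} (hq : q ≠ 0)
include hq

lemma freeRep_rel {x y : FreeAlgebra ℂ (Fin 4)} (h : LRel ℂ (q ^ 2) ((q ^ 2)⁻¹) x y) :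
    freeRep q x = freeRep q y := by
  have hs : (C (C q) * C (C q⁻¹) : ℂ[X][X]) = 1 := by
    rw [← C_mul, ← C_mul, mul_inv_cancel₀ hq, C_1, C_1]
  have hs1 : q ^ 2 * (q ^ 2)⁻¹ = 1 := mul_inv_cancel₀ (pow_ne_zero 2 hq)
  have hs2 : (q ^ 2)⁻¹ * q ^ 2 = 1 := inv_mul_cancel₀ (pow_ne_zero 2 hq)
  have e1 : (C (C (q ^ 2)) : ℂ[X][X]) = C (C q) ^ 2 := by rw [map_pow, map_pow]
  have e2 : (C (C (q ^ 2)⁻¹) : ℂ[X][X]) = C (C q⁻¹) ^ 2 := by rw [← inv_pow, map_pow, map_pow]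
  have e3 (r : ℂ) (f : ℂ[X][X]) : r • f = C (C r) * f := by
    rw [Algebra.smul_def]; rfl
  cases h <;> refine LinearMap.ext fun h => funext fun n => ?_ <;>
    simp only [map_mul, map_neg, map_sub (freeRep q), map_one (freeRep q), AlgHom.commutes,
      freeRep_gA, freeRep_gB, freeRep_gC, freeRep_gD, Module.End.mul_apply, LinearMap.sub_apply,
      LinearMap.neg_apply, Pi.sub_apply, Pi.neg_apply, mulOp_apply, shiftOp_apply,
      Module.algebraMap_end_apply, Pi.smul_apply, Module.End.one_apply, e3, scaleVar_X, scaleVar_C,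
      scaleVar_scaleVar, hs1, hs2, scaleVar_one, map_sub, map_one, weylPoly, e1, e2,
      map_pow (scaleVar (q ^ 2)⁻¹), map_pow (scaleVar (q ^ 2)),
      sub_neg_eq_add, sub_add_cancel, add_sub_cancel_right]
  · ring
  · ring
  · linear_combination (-(C (C q) * C (C q⁻¹) + 1) * X * scaleVar (q ^ 2)⁻¹ (h (n - 1))) * hs
  · ring
  · ring
  · linear_combination ((C (C q) * C (C q⁻¹) + 1) * X * scaleVar (q ^ 2) (h (n + 1)) *
      (C (C q⁻¹) * C X * X - X ^ 2 - C (C q⁻¹) ^ 2)) * hs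
  · linear_combination ((C (C q) * C (C q⁻¹) + 1) * h n *
      (1 - C (C q⁻¹) * C X * X + C (C q⁻¹) ^ 2 * X ^ 2)) * hs

omit hq in
/-- The action of `Lspec q` on skew Laurent series. -/
def lspecRep (hq : q ≠ 0) : Lspec q →ₐ[ℂ] Module.End ℂ (ℤ → ℂ[X][X]) :=
  RingQuot.liftAlgHom ℂ ⟨freeRep q, fun _ _ => freeRep_rel hq⟩

lemma lspecRep_mk (x : FreeAlgebra ℂ (Fin 4)) : lspecRep hq (mkLspec q x) = freeRep q x :=
  RingQuot.liftAlgHom_mkAlgHom_apply ℂ _ _ x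

lemma lspecRep_lb : lspecRep hq (lb q) = shiftOp (q ^ 2)⁻¹ 1 :=
  (lspecRep_mk hq _).trans (freeRep_gB q)

lemma lspecRep_lc : lspecRep hq (lc q) = mulOp (weylPoly q) * shiftOp (q ^ 2) (-1) :=
  (lspecRep_mk hq _).trans (freeRep_gC q)

lemma lspecRep_ld : lspecRep hq (ld q) = mulOp X :=
  (lspecRep_mk hq _).trans (freeRep_gD q)

lemma lspecRep_la : lspecRep hq (la q) = mulOp (C (C q⁻¹ * X) - C (C (q ^ 2)⁻¹) * X) :=
  (lspecRep_mk hq _).trans (freeRep_gA q)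

end Representation

section NormalFormUnique

variable {q : ℂ} (hq : q ≠ 0)
include hq

lemma lspecRep_iotaL (f : ℂ[X][X]) : lspecRep hq (iotaL hq f) = mulOp f := by
  have hX : lspecRep hq (omegaL q) = mulOp (C X) := by
    rw [omegaL_eq, map_add, map_smul, map_smul, lspecRep_la, lspecRep_ld]
    refine LinearMap.ext fun h => funext fun n => ?_
    have hs : (C (C q) * C (C q⁻¹) : ℂ[X][X]) = 1 := by
      rw [← C_mul, ← C_mul, mul_inv_cancel₀ hq, C_1, C_1]
    have e2 : (C (C (q ^ 2)⁻¹) : ℂ[X][X]) = C (C q⁻¹) ^ 2 := by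
      rw [← inv_pow, map_pow, map_pow]
    have e3 (r : ℂ) (f : ℂ[X][X]) : r • f = C (C r) * f := by
      rw [Algebra.smul_def]; rfl
    simp only [LinearMap.add_apply, LinearMap.smul_apply, Pi.add_apply, Pi.smul_apply,
      mulOp_apply, e2, e3, C_mul]
    linear_combination (C X * h n - X * C (C q⁻¹) * h n) * hs
  have hCC (z : ℂ) : lspecRep hq (algebraMap ℂ _ z) = mulOp (C (C z)) := by
    rw [AlgHom.commutes]
    refine LinearMap.ext fun h => funext fun n => ?_
    rw [Module.algebraMap_end_apply, Pi.smul_apply, Algebra.smul_def, mulOp_apply]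
    rfl
  have hmul (f g : ℂ[X][X]) : mulOp (f * g) = mulOp f * mulOp g :=
    LinearMap.ext fun h => funext fun n => mul_assoc _ _ _
  have hadd (f g : ℂ[X][X]) : mulOp (f + g) = mulOp f + mulOp g :=
    LinearMap.ext fun h => funext fun n => add_mul _ _ _
  induction f using Polynomial.induction_on with
  | C a =>
    induction a using Polynomial.induction_on with
    | C z => rw [iotaL_C_C, hCC]
    | add f g hf hg => rw [C_add, map_add, map_add, hf, hg, hadd]
    | monomial n z ih =>
      rw [pow_succ, ← mul_assoc, C_mul, map_mul, map_mul, ih, hmul, iotaL_C hq X, aeval_X, hX]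
  | add f g hf hg => rw [map_add, map_add, hf, hg, hadd]
  | monomial n a ih => rw [pow_succ, ← mul_assoc, map_mul, map_mul, ih, hmul _ X, iotaL_X, lspecRep_ld]

omit hq in
/-- The coefficients of an element of `Lspec q` in the skew Laurent ring. -/
def lspecCoeff (hq : q ≠ 0) (x : Lspec q) : ℤ → ℂ[X][X] := lspecRep hq x (Pi.single 0 1)

lemma lspecCoeff_weylPow (n : ℤ) :
    ∃ g : ℂ[X][X], g ≠ 0 ∧ lspecCoeff hq (weylPow (lb q) (lc q) n) = Pi.single n g := by
  have hne {z : ℂ} (hz : z ≠ 0) {f : ℂ[X][X]} (hf : f ≠ 0) : scaleVar z f ≠ 0 := by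
    intro h
    apply hf
    rw [← scaleVar_one f, ← inv_mul_cancel₀ hz, ← scaleVar_scaleVar, h, map_zero]
  have hshift (z : ℂ) (k n : ℤ) (f : ℂ[X][X]) :
      shiftOp z k (Pi.single n f) = Pi.single (n + k) (scaleVar z f) := by
    funext m
    rw [shiftOp_apply]
    by_cases hm : m = n + k
    · subst hm; simp
    · rw [Pi.single_eq_of_ne hm, Pi.single_eq_of_ne (by omega), map_zero]
  have hmul (n : ℤ) (f g : ℂ[X][X]) : mulOp f (Pi.single n g) = Pi.single n (f * g) := by
    funext m
    rw [mulOp_apply]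
    by_cases hm : m = n
    · subst hm; simp
    · rw [Pi.single_eq_of_ne hm, Pi.single_eq_of_ne hm, mul_zero]
  have hq2 : q ^ 2 ≠ 0 := pow_ne_zero 2 hq
  cases n with
  | ofNat k =>
    induction k with
    | zero =>
      refine ⟨1, one_ne_zero, ?_⟩
      simp [weylPow, lspecCoeff]
    | succ k ih =>
      obtain ⟨g, hg, h⟩ := ih
      refine ⟨scaleVar (q ^ 2)⁻¹ g, hne (inv_ne_zero hq2) hg, ?_⟩
      simp only [weylPow, lspecCoeff] at h ⊢
      rw [pow_succ', map_mul, Module.End.mul_apply, h, lspecRep_lb, hshift]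
      rfl
  | negSucc k =>
    have key (m : ℕ) :
        ∃ g : ℂ[X][X], g ≠ 0 ∧ lspecCoeff hq (lc q ^ m) = Pi.single (-(m : ℤ)) g := by
      induction m with
      | zero =>
        refine ⟨1, one_ne_zero, ?_⟩
        simp [lspecCoeff]
      | succ m ih =>
        obtain ⟨g, hg, h⟩ := ih
        refine ⟨weylPoly q * scaleVar (q ^ 2) g, mul_ne_zero (weylPoly_ne_zero q) (hne hq2 hg), ?_⟩
        simp only [lspecCoeff] at h ⊢
        rw [pow_succ', map_mul, Module.End.mul_apply, h, lspecRep_lc, Module.End.mul_apply,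
          hshift, hmul, Nat.cast_succ, neg_add]
    rw [Int.negSucc_eq]; exact_mod_cast key (k + 1)

lemma lspecCoeff_iotaL_mul (f : ℂ[X][X]) (x : Lspec q) (n : ℤ) :
    lspecCoeff hq (iotaL hq f * x) n = f * lspecCoeff hq x n := by
  rw [lspecCoeff, map_mul, lspecRep_iotaL, Module.End.mul_apply, mulOp_apply]; rfl

omit hq in
/-- The leading coefficient of `weylPow b c n` in the skew Laurent ring. -/
def weylCoeff (hq : q ≠ 0) (n : ℤ) : ℂ[X][X] := lspecCoeff hq (weylPow (lb q) (lc q) n) n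

lemma weylCoeff_ne_zero (n : ℤ) : weylCoeff hq n ≠ 0 := by
  obtain ⟨g, hg, h⟩ := lspecCoeff_weylPow hq n
  rw [weylCoeff, h, Pi.single_eq_same]
  exact hg

lemma lspecCoeff_weylPow_of_ne {m n : ℤ} (hmn : m ≠ n) :
    lspecCoeff hq (weylPow (lb q) (lc q) n) m = 0 := by
  obtain ⟨g, -, h⟩ := lspecCoeff_weylPow hq n
  rw [h, Pi.single_eq_of_ne hmn]

lemma lspecCoeff_sum {κ : Type*} (s : Finset κ) (f : κ → ℂ[X][X]) (e : κ → ℤ)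
    (he : Function.Injective e) (i : κ) (hi : i ∉ s → f i = 0) :
    lspecCoeff hq (∑ j ∈ s, iotaL hq (f j) * weylPow (lb q) (lc q) (e j)) (e i) =
      f i * weylCoeff hq (e i) := by
  classical
  have : lspecCoeff hq (∑ j ∈ s, iotaL hq (f j) * weylPow (lb q) (lc q) (e j)) (e i) =
      ∑ j ∈ s, lspecCoeff hq (iotaL hq (f j) * weylPow (lb q) (lc q) (e j)) (e i) := by
    simp only [lspecCoeff, map_sum, LinearMap.sum_apply, Finset.sum_apply]
  rw [this, Finset.sum_eq_single i]
  · exact lspecCoeff_iotaL_mul hq _ _ _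
  · intro j _ hj
    rw [lspecCoeff_iotaL_mul, lspecCoeff_weylPow_of_ne hq (fun h => hj (he h).symm), mul_zero]
  · intro h
    rw [hi h, map_zero, zero_mul]
    simp [lspecCoeff]

lemma lspecCoeff_weylSum (h : ℤ →₀ ℂ[X][X]) (n : ℤ) :
    lspecCoeff hq (weylSum (iotaL hq) (lb q) (lc q) h) n = h n * weylCoeff hq n := by
  rw [weylSum_apply]
  exact lspecCoeff_sum hq h.support h id Function.injective_id n Finsupp.notMem_support_iff.1

lemma commute_lspecRep {T : Module.End ℂ (ℤ → ℂ[X][X])} (hm : ∀ f, Commute T (mulOp f))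
    (hb : Commute T (shiftOp (q ^ 2)⁻¹ 1)) (hc : Commute T (shiftOp (q ^ 2) (-1)))
    (x : Lspec q) : Commute T (lspecRep hq x) := by
  have hx : x ∈ Algebra.adjoin ℂ {la q, lb q, lc q, ld q} := by rw [Lspec_adjoin]; trivial
  have hle : Algebra.adjoin ℂ {la q, lb q, lc q, ld q} ≤
      (Subalgebra.centralizer ℂ {T}).comap (lspecRep hq) := by
    rw [Algebra.adjoin_le_iff]
    rintro z (rfl | rfl | rfl | rfl) w rfl
    · change Commute w (lspecRep hq (la q)); rw [lspecRep_la]; exact hm _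
    · change Commute w (lspecRep hq (lb q)); rw [lspecRep_lb]; exact hb
    · change Commute w (lspecRep hq (lc q)); rw [lspecRep_lc]; exact (hm _).mul_right hc
    · change Commute w (lspecRep hq (ld q)); rw [lspecRep_ld]; exact hm _
  exact hle hx T rfl

lemma scaleVar_lspecCoeff_of_mem_center {x : Lspec q} (hx : x ∈ Subalgebra.center ℂ (Lspec q))
    (n : ℤ) : scaleVar (q ^ 2)⁻¹ (lspecCoeff hq x n) = lspecCoeff hq x n := by
  have hT : Commute (shiftOp 1 1) (lspecRep hq x) := by
    apply commute_lspecRep hq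
    · intro f
      refine LinearMap.ext fun h => funext fun m => ?_
      simp only [Module.End.mul_apply, mulOp_apply, shiftOp_apply, scaleVar_one]
    all_goals
      refine LinearMap.ext fun h => funext fun m => ?_
      simp only [Module.End.mul_apply, shiftOp_apply, scaleVar_scaleVar, one_mul, mul_one]
      try congr 2; ring
  have h0 : shiftOp 1 1 (Pi.single 0 1) = lspecRep hq (lb q) (Pi.single 0 1) := by
    funext m
    rw [lspecRep_lb, shiftOp_apply, shiftOp_apply]
    by_cases hm : m - 1 = 0
    · simp [hm]
    · simp [Pi.single_eq_of_ne hm]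
  have h1 := LinearMap.congr_fun hT.eq (Pi.single 0 1)
  rw [Module.End.mul_apply, Module.End.mul_apply, h0, ← Module.End.mul_apply (lspecRep hq x),
    ← map_mul, ← Subalgebra.mem_center_iff.1 hx, map_mul, lspecRep_lb] at h1
  have h2 := congrFun h1 (n + 1)
  rw [Module.End.mul_apply, shiftOp_apply, shiftOp_apply, scaleVar_one, add_sub_cancel_right] at h2
  exact h2.symm

lemma twist_lspecCoeff_of_mem_center {x : Lspec q} (hx : x ∈ Subalgebra.center ℂ (Lspec q))
    (n : ℤ) : C (C ((q ^ 2)⁻¹ ^ n)) * X * lspecCoeff hq x n = X * lspecCoeff hq x n := by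
  have hq2 : q ^ 2 ≠ 0 := pow_ne_zero 2 hq
  have hT : Commute (twistOp (q ^ 2)⁻¹) (lspecRep hq x) := by
    apply commute_lspecRep hq
    · intro f
      refine LinearMap.ext fun h => funext fun m => ?_
      simp only [Module.End.mul_apply, mulOp_apply, twistOp_apply]
      ring
    · refine LinearMap.ext fun h => funext fun m => ?_
      simp only [Module.End.mul_apply, shiftOp_apply, twistOp_apply, map_mul, scaleVar_C,
        scaleVar_X]
      rw [← mul_assoc, ← C_mul, ← C_mul, ← zpow_add_one₀ (inv_ne_zero hq2), sub_add_cancel]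
    · refine LinearMap.ext fun h => funext fun m => ?_
      simp only [Module.End.mul_apply, shiftOp_apply, twistOp_apply, map_mul, scaleVar_C,
        scaleVar_X]
      rw [← mul_assoc, ← C_mul, ← C_mul, sub_neg_eq_add, zpow_add_one₀ (inv_ne_zero hq2),
        inv_mul_cancel_right₀ hq2]
  have h0 : twistOp (q ^ 2)⁻¹ (Pi.single 0 1) = lspecRep hq (ld q) (Pi.single 0 1) := by
    funext m
    rw [lspecRep_ld, twistOp_apply, mulOp_apply]
    by_cases hm : m = 0
    · subst hm; simp
    · simp [Pi.single_eq_of_ne hm]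
  have h1 := LinearMap.congr_fun hT.eq (Pi.single 0 1)
  rw [Module.End.mul_apply, Module.End.mul_apply, h0, ← Module.End.mul_apply (lspecRep hq x),
    ← map_mul, ← Subalgebra.mem_center_iff.1 hx, map_mul, lspecRep_ld] at h1
  exact congrFun h1 n

end NormalFormUnique

section RootOfUnity

lemma _root_.IsPrimitiveRoot.prod_range_sub_pow_mul {K : Type*} [CommRing K] [IsDomain K] {s : K}
    {l : ℕ} (hs : IsPrimitiveRoot s l) (hl : 0 < l) (x y : K) :
    ∏ j ∈ Finset.range l, (x - s ^ j * y) = x ^ l - y ^ l := by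
  rw [hs.pow_sub_pow_eq_prod_sub_mul x y hl]
  refine Finset.prod_nbij (s ^ ·) ?_ ?_ ?_ fun _ _ => rfl
  · intro j _
    rw [mem_nthRootsFinset hl, ← pow_mul, mul_comm, pow_mul, hs.pow_eq_one, one_pow]
  · intro i hi j hj hij
    exact hs.pow_inj (Finset.mem_range.1 hi) (Finset.mem_range.1 hj) hij
  · intro z hz
    have : NeZero l := ⟨hl.ne'⟩
    obtain ⟨i, hi, rfl⟩ := hs.eq_pow_of_pow_eq_one ((mem_nthRootsFinset hl 1).1 hz)
    exact ⟨i, Finset.mem_coe.2 (Finset.mem_range.2 hi), rfl⟩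

lemma map_aeval_int {A B : Type*} [CommRing A] [CommRing B] [Algebra ℤ A] [Algebra ℤ B]
    (f : A →+* B) (x : A) (P : ℤ[X]) : f (aeval x P) = aeval (f x) P := by
  rw [aeval_def, hom_eval₂, aeval_def]
  congr 1
  exact Subsingleton.elim _ _

lemma Complex.exists_add_inv_eq (w : ℂ) : ∃ u : ℂ, u ≠ 0 ∧ u + u⁻¹ = w := by
  obtain ⟨z, hz⟩ := IsAlgClosed.exists_pow_nat_eq (w ^ 2 - 4) (n := 2) (by norm_num)
  have hu : (w + z) / 2 ≠ 0 := by
    intro h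
    have : z = -w := by linear_combination 2 * h
    rw [this] at hz
    have h4 : (4 : ℂ) = 0 := by linear_combination hz
    norm_num at h4
  refine ⟨(w + z) / 2, hu, ?_⟩
  rw [← mul_left_inj' hu, add_mul, inv_mul_cancel₀ hu]
  linear_combination hz / 4

/-- The polynomial representing `c ^ l * b ^ l`, in terms of `ω` and `d ^ l`. -/
def chebyPoly (P : ℤ[X]) : ℂ[X][X] := (aeval (C X) P - X) * X - 1

variable {l : ℕ} (hodd : Odd l) {ε : ℂ} (hε : IsPrimitiveRoot ε l)
include hodd hε

lemma isPrimitiveRoot_sq : IsPrimitiveRoot (ε ^ 2) l :=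
  hε.pow_of_coprime 2 hodd.coprime_two_left

lemma prod_scaleVar_weylPoly {P : ℤ[X]}
    (hP : ∀ u : ℂ, u ≠ 0 → aeval (u + u⁻¹) P = u ^ l + u⁻¹ ^ l) :
    ∏ j ∈ Finset.range l, scaleVar ((ε ^ 2) ^ j) (weylPoly ε) =
      expand ℂ[X] l (chebyPoly P) := by
  refine Polynomial.funext fun r => Polynomial.funext fun w => ?_
  let e : ℂ[X][X] →+* ℂ := (evalRingHom w).comp (evalRingHom r)
  change e _ = e _
  have hX : e X = r.eval w := by simp [e]
  have hC (f : ℂ[X]) : e (C f) = f.eval w := by simp [e]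
  have hε0 : ε ≠ 0 := hε.ne_zero hodd.pos.ne'
  obtain ⟨u, hu, rfl⟩ := Complex.exists_add_inv_eq w
  have key : ∀ j ∈ Finset.range l, e (scaleVar ((ε ^ 2) ^ j) (weylPoly ε)) =
      -((ε⁻¹ * u - (ε ^ 2) ^ j * e X) * (ε⁻¹ * u⁻¹ - (ε ^ 2) ^ j * e X)) := by
    intro j _
    simp only [weylPoly, map_sub, map_mul, map_pow, scaleVar_X, scaleVar_C, hC, eval_C,
      eval_X]
    field_simp
    ring
  have hl1 : ε⁻¹ ^ l = 1 := by rw [inv_pow, hε.pow_eq_one, inv_one]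
  have hs := isPrimitiveRoot_sq hodd hε
  rw [map_prod, Finset.prod_congr rfl key, Finset.prod_neg, Finset.prod_mul_distrib,
    hs.prod_range_sub_pow_mul hodd.pos, hs.prod_range_sub_pow_mul hodd.pos, Finset.card_range,
    hodd.neg_one_pow, mul_pow, mul_pow, hl1]
  have hP' := hP u hu
  simp only [chebyPoly, map_sub, map_mul, map_one, expand_X, map_pow]
  rw [← RingHom.coe_coe (expand ℂ[X] l), map_aeval_int, map_aeval_int, RingHom.coe_coe, expand_C,
    hC, eval_X, hP']
  have hinv : u ^ l * u⁻¹ ^ l = 1 := by rw [← mul_pow, mul_inv_cancel₀ hu, one_pow]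
  linear_combination -hinv

omit hε in
lemma scaleVar_expand {z : ℂ} (hz : z ^ l = 1) (f : ℂ[X][X]) :
    scaleVar z (expand ℂ[X] l f) = expand ℂ[X] l f := by
  ext n : 1
  rw [coeff_scaleVar, coeff_expand hodd.pos]
  split_ifs with h
  · obtain ⟨k, rfl⟩ := h
    rw [← C_pow, pow_mul, hz, one_pow, C_1, mul_one]
  · rw [zero_mul]

lemma exists_expand_eq {f : ℂ[X][X]} (hf : scaleVar (ε ^ 2)⁻¹ f = f) :
    ∃ g, expand ℂ[X] l g = f := by
  refine ⟨contract l f, ?_⟩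
  ext n : 1
  rw [coeff_expand hodd.pos]
  split_ifs with h
  · rw [coeff_contract hodd.pos.ne', Nat.div_mul_cancel h]
  · have h1 := congrArg (fun p => p.coeff n) hf
    simp only [coeff_scaleVar] at h1
    have h2 : f.coeff n * (C ((ε ^ 2)⁻¹ ^ n) - 1) = 0 := by
      rw [C_pow]; linear_combination h1
    rcases mul_eq_zero.1 h2 with h3 | h3
    · exact h3.symm
    · exfalso
      rw [sub_eq_zero, ← C_1, C_inj] at h3
      exact h ((isPrimitiveRoot_sq hodd hε).inv.dvd_of_pow_eq_one _ h3)

lemma ld_pow_mem_center : ld ε ^ l ∈ Subalgebra.center ℂ (Lspec ε) := by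
  have hε0 : ε ≠ 0 := hε.ne_zero hodd.pos.ne'
  have hs := (isPrimitiveRoot_sq hodd hε)
  have h : ld ε ^ l = iotaL hε0 (expand ℂ[X] l X) := by rw [expand_X, map_pow, iotaL_X]
  refine mem_center_of_commute_lb_lc_ld hε0 ?_ ?_ ((Commute.refl _).pow_left l)
  · refine Commute.symm ?_
    rw [h, Commute, SemiconjBy, lb_mul_iotaL, scaleVar_expand hodd hs.inv.pow_eq_one]
  · refine Commute.symm ?_
    rw [h, Commute, SemiconjBy, lc_mul_iotaL, scaleVar_expand hodd hs.pow_eq_one]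

lemma lb_pow_mem_center : lb ε ^ l ∈ Subalgebra.center ℂ (Lspec ε) := by
  have hε0 : ε ≠ 0 := hε.ne_zero hodd.pos.ne'
  have hs := (isPrimitiveRoot_sq hodd hε)
  refine mem_center_of_commute_lb_lc_ld hε0 ((Commute.refl _).pow_left l) ?_ ?_
  · obtain ⟨k, hk⟩ : ∃ k, l = k + 1 := Nat.exists_eq_succ_of_ne_zero hodd.pos.ne'
    rw [Commute, SemiconjBy]
    conv_lhs => rw [hk, pow_succ, mul_assoc, lb_mul_lc_iotaL hε0, lb_pow_mul_iotaL,
      scaleVar_scaleVar, ← pow_succ, ← hk, hs.inv.pow_eq_one, scaleVar_one]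
    rw [hk, pow_succ' (lb ε), ← mul_assoc, lc_mul_lb_iotaL hε0]
  · rw [Commute, SemiconjBy, ← iotaL_X hε0, lb_pow_mul_iotaL, hs.inv.pow_eq_one, scaleVar_one]

lemma lc_pow_mem_center : lc ε ^ l ∈ Subalgebra.center ℂ (Lspec ε) := by
  have hε0 : ε ≠ 0 := hε.ne_zero hodd.pos.ne'
  have hs := (isPrimitiveRoot_sq hodd hε)
  refine mem_center_of_commute_lb_lc_ld hε0 ?_ ((Commute.refl _).pow_left l) ?_
  · obtain ⟨k, hk⟩ : ∃ k, l = k + 1 := Nat.exists_eq_succ_of_ne_zero hodd.pos.ne'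
    have hk1 : (ε ^ 2) ^ k = (ε ^ 2)⁻¹ := by
      refine eq_inv_of_mul_eq_one_left ?_
      rw [← pow_succ, ← hk, hs.pow_eq_one]
    rw [Commute, SemiconjBy, hk]
    conv_lhs => rw [pow_succ, mul_assoc, lc_mul_lb_iotaL hε0, lc_pow_mul_iotaL, hk1]
    rw [pow_succ' (lc ε), ← mul_assoc, lb_mul_lc_iotaL hε0]
  · rw [Commute, SemiconjBy, ← iotaL_X hε0, lc_pow_mul_iotaL, hs.pow_eq_one, scaleVar_one]

lemma weylPow_mem_center (n : ℤ) :
    weylPow (lb ε) (lc ε) (l * n) ∈ Subalgebra.center ℂ (Lspec ε) := by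
  rw [← weylPow_pow _ _ l hodd.pos.ne']
  cases n with
  | ofNat k => exact pow_mem (lb_pow_mem_center hodd hε) k
  | negSucc k => exact pow_mem (lc_pow_mem_center hodd hε) (k + 1)

/-- The coefficients of a central element lie in `ℂ[ω, d ^ l]`, in degrees divisible by `l`. -/
lemma coeff_of_weylSum_mem_center (hε0 : ε ≠ 0) (h : ℤ →₀ ℂ[X][X])
    (hx : weylSum (iotaL hε0) (lb ε) (lc ε) h ∈ Subalgebra.center ℂ (Lspec ε)) {n : ℤ}
    (hn : h n ≠ 0) : (l : ℤ) ∣ n ∧ ∃ g, expand ℂ[X] l g = h n := by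
  have hs := (isPrimitiveRoot_sq hodd hε).inv
  have hG := weylCoeff_ne_zero hε0
  have hdvd : (l : ℤ) ∣ n := by
    have h1 := twist_lspecCoeff_of_mem_center hε0 hx n
    rw [lspecCoeff_weylSum] at h1
    have h2 : (C (C ((ε ^ 2)⁻¹ ^ n)) - 1) * (X * (h n * weylCoeff hε0 n)) = 0 := by
      linear_combination h1
    rcases mul_eq_zero.1 h2 with h3 | h3
    · rw [sub_eq_zero, ← C_1, C_inj, ← C_1, C_inj] at h3
      exact (hs.zpow_eq_one_iff_dvd n).1 h3
    · exact absurd h3 (mul_ne_zero X_ne_zero (mul_ne_zero hn (hG n)))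
  refine ⟨hdvd, exists_expand_eq hodd hε ?_⟩
  obtain ⟨m, rfl⟩ := hdvd
  have h1 := scaleVar_lspecCoeff_of_mem_center hε0 hx (l * m)
  have h2 := scaleVar_lspecCoeff_of_mem_center hε0 (weylPow_mem_center hodd hε m) (l * m)
  rw [lspecCoeff_weylSum, map_mul, weylCoeff, h2] at h1
  exact mul_right_cancel₀ (hG (l * m)) h1

end RootOfUnity

section CommutativeSide

/-- The embedding of `ℂ[W][T]` into `ℂ[W, X, Y, T]`. -/
def thetaHom : ℂ[X][X] →+* MvPolynomial (Fin 4) ℂ :=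
  eval₂RingHom (Polynomial.aeval (MvPolynomial.X 0 : MvPolynomial (Fin 4) ℂ)).toRingHom
    (MvPolynomial.X 3)

lemma thetaHom_X : thetaHom X = MvPolynomial.X 3 := by simp [thetaHom]

lemma thetaHom_C (f : ℂ[X]) : thetaHom (C f) = aeval (MvPolynomial.X 0) f := by simp [thetaHom]

lemma thetaHom_chebyPoly (P : ℤ[X]) : thetaHom (chebyPoly P) =
    (aeval (MvPolynomial.X 0 : MvPolynomial (Fin 4) ℂ) P - MvPolynomial.X 3) * MvPolynomial.X 3
      - 1 := by
  rw [chebyPoly, map_sub, map_mul, map_sub, map_aeval_int, thetaHom_X, thetaHom_C, aeval_X, map_one]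

variable {l : ℕ} {ε : ℂ} (hε0 : ε ≠ 0) (φ : MvPolynomial (Fin 4) ℂ →ₐ[ℂ] Lspec ε)
  (h0 : φ (MvPolynomial.X 0) = omegaL ε) (h3 : φ (MvPolynomial.X 3) = ld ε ^ l)
include h0 h3

lemma map_thetaHom (f : ℂ[X][X]) : φ (thetaHom f) = iotaL hε0 (expand ℂ[X] l f) := by
  have : (φ : MvPolynomial (Fin 4) ℂ →+* Lspec ε).comp thetaHom =
      (iotaL hε0).comp (expand ℂ[X] l : ℂ[X][X] →+* ℂ[X][X]) := by
    refine Polynomial.ringHom_ext (fun a => ?_) ?_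
    · simp only [RingHom.comp_apply, RingHom.coe_coe, thetaHom_C, expand_C, iotaL_C, ← h0,
        aeval_algHom_apply]
    · simp only [RingHom.comp_apply, RingHom.coe_coe, thetaHom_X, expand_X, map_pow, iotaL_X, h3]
  exact RingHom.congr_fun this f

variable (hodd : Odd l) (hε : IsPrimitiveRoot ε l)
  (h1 : φ (MvPolynomial.X 1) = lb ε ^ l) (h2 : φ (MvPolynomial.X 2) = lc ε ^ l)
include hodd hε h1 h2

lemma range_eq_center : φ.range = Subalgebra.center ℂ (Lspec ε) := by
  have hε0 : ε ≠ 0 := hε.ne_zero hodd.pos.ne'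
  apply le_antisymm
  · rintro _ ⟨p, rfl⟩
    change φ p ∈ _
    induction p using MvPolynomial.induction_on with
    | C z =>
      rw [← MvPolynomial.algebraMap_eq, AlgHom.commutes]
      exact Subalgebra.algebraMap_mem _ z
    | add p p' hp hp' => rw [map_add]; exact add_mem hp hp'
    | mul_X p i hp =>
      rw [map_mul]
      refine mul_mem hp ?_
      fin_cases i
      · exact h0 ▸ omegaL_mem_center hε0
      · exact h1 ▸ lb_pow_mem_center hodd hε
      · exact h2 ▸ lc_pow_mem_center hodd hε
      · exact h3 ▸ ld_pow_mem_center hodd hε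
  · intro x hx
    obtain ⟨h, rfl⟩ := weylSum_iotaL_surjective hε0 x
    have hh := fun n => coeff_of_weylSum_mem_center hodd hε hε0 h hx (n := n)
    rw [weylSum_apply]
    refine sum_mem fun n hn => ?_
    obtain ⟨⟨m, rfl⟩, g, hg⟩ := hh n (Finsupp.mem_support_iff.1 hn)
    rw [← hg, ← map_thetaHom hε0 φ h0 h3, ← weylPow_pow _ _ l hodd.pos.ne', ← h1, ← h2]
    have := map_weylPow (φ : MvPolynomial (Fin 4) ℂ →+* Lspec ε)
      (MvPolynomial.X 1) (MvPolynomial.X 2) m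
    exact mul_mem ⟨_, rfl⟩ ⟨_, this⟩

lemma ker_eq_span (P : ℤ[X]) (hP : ∀ u : ℂ, u ≠ 0 → aeval (u + u⁻¹) P = u ^ l + u⁻¹ ^ l) :
    RingHom.ker (φ : MvPolynomial (Fin 4) ℂ →+* Lspec ε) =
      Ideal.span {thetaHom (chebyPoly P) - MvPolynomial.X 1 * MvPolynomial.X 2} := by
  have hε0 : ε ≠ 0 := hε.ne_zero hodd.pos.ne'
  set I := Ideal.span {thetaHom (chebyPoly P) - MvPolynomial.X 1 * MvPolynomial.X 2} with hI
  have hle : I ≤ RingHom.ker (φ : MvPolynomial (Fin 4) ℂ →+* Lspec ε) := by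
    rw [hI, Ideal.span_singleton_le_iff_mem, RingHom.mem_ker, RingHom.coe_coe, map_sub, map_mul,
      h1, h2, map_thetaHom hε0 φ h0 h3, ← prod_scaleVar_weylPoly hodd hε hP,
      ← lc_pow_mul_lb_pow, Subalgebra.mem_center_iff.1 (lb_pow_mem_center hodd hε), sub_self]
  refine le_antisymm (fun p hp => ?_) hle
  rw [RingHom.mem_ker, RingHom.coe_coe] at hp
  let π := Ideal.Quotient.mk I
  have hF : π (MvPolynomial.X 1) * π (MvPolynomial.X 2) = (π.comp thetaHom) (chebyPoly P) := by
    rw [← map_mul, RingHom.comp_apply, eq_comm, Ideal.Quotient.eq]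
    exact Ideal.subset_span rfl
  have hgen (p : MvPolynomial (Fin 4) ℂ) : π p ∈ Subring.closure
      (Set.range (π.comp thetaHom) ∪ {π (MvPolynomial.X 1), π (MvPolynomial.X 2)}) := by
    induction p using MvPolynomial.induction_on with
    | C z =>
      refine Subring.subset_closure (Or.inl ⟨C (C z), ?_⟩)
      rw [RingHom.comp_apply, thetaHom_C, aeval_C]; rfl
    | add p p' hp hp' => rw [map_add]; exact add_mem hp hp'
    | mul_X p i hp =>
      rw [map_mul]
      refine mul_mem hp (Subring.subset_closure ?_)
      fin_cases i
      · exact Or.inl ⟨C X, by rw [RingHom.comp_apply, thetaHom_C, aeval_X]; rfl⟩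
      · exact Or.inr (Or.inl rfl)
      · exact Or.inr (Or.inr rfl)
      · exact Or.inl ⟨X, by rw [RingHom.comp_apply, thetaHom_X]; rfl⟩
  have hπ (p : MvPolynomial (Fin 4) ℂ) :
      Ideal.Quotient.lift I (φ : MvPolynomial (Fin 4) ℂ →+* Lspec ε) hle (π p) = φ p :=
    Ideal.Quotient.lift_mk I _ hle
  obtain ⟨h, hh⟩ := mem_range_weylSum (π.comp thetaHom) (RingHom.id _) (RingHom.id _)
    (chebyPoly P) (chebyPoly P) _ _ (fun f => mul_comm _ _) (fun f => mul_comm _ _)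
    ((mul_comm _ _).trans hF) hF _ (hgen p)
  have h4 : φ p = ∑ n ∈ h.support,
      iotaL hε0 (expand ℂ[X] l (h n)) * weylPow (lb ε) (lc ε) (l * n) := by
    have := congrArg (Ideal.Quotient.lift I (φ : MvPolynomial (Fin 4) ℂ →+* Lspec ε) hle) hh
    rw [hπ] at this
    rw [← this, weylSum_apply, map_sum]
    refine Finset.sum_congr rfl fun n _ => ?_
    rw [map_mul, map_weylPow, RingHom.comp_apply, hπ, hπ, hπ, h1, h2, map_thetaHom hε0 φ h0 h3,
      weylPow_pow _ _ l hodd.pos.ne']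
  have h5 : h = 0 := by
    ext n : 1
    have hinj : Function.Injective fun n : ℤ => (l : ℤ) * n :=
      mul_right_injective₀ (by exact_mod_cast hodd.pos.ne')
    have h6 := lspecCoeff_sum hε0 h.support (fun n => expand ℂ[X] l (h n)) _ hinj n
      (fun hn => by simp [Finsupp.notMem_support_iff.1 hn])
    rw [← h4, hp] at h6
    have h7 : lspecCoeff hε0 0 (l * n) = 0 := by simp [lspecCoeff]
    rw [h7, eq_comm, mul_eq_zero, or_iff_left (weylCoeff_ne_zero hε0 _)] at h6
    exact (expand_eq_zero hodd.pos).1 h6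
  rw [h5, map_zero] at hh
  exact Ideal.Quotient.eq_zero_iff_mem.1 hh.symm

end CommutativeSide

lemma exists_center_algHom {A : Type*} [Ring A] [Algebra ℂ A] (x : Fin 4 → A)
    (hx : ∀ i, x i ∈ Subalgebra.center ℂ A) :
    ∃ φ : MvPolynomial (Fin 4) ℂ →ₐ[ℂ] A, ∀ i, φ (MvPolynomial.X i) = x i :=
  ⟨(Subalgebra.center ℂ A).val.comp (MvPolynomial.aeval fun i => ⟨x i, hx i⟩), fun i => by simp⟩

/-- Let `l ≥ 3` be odd, `ε` a primitive `l`-th root of unity, and `T_l` the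
rescaled Chebyshev polynomial of the first kind (the unique integer polynomial with
`T_l(u + u⁻¹) = u^l + u⁻ˡ` for all invertible `u`).  Let `φ : ℂ[W,X,Y,T] → 𝓛(ε)` be the
ℂ-algebra homomorphism determined by `φ(W) = ω`, `φ(X) = bˡ`, `φ(Y) = cˡ`, `φ(T) = dˡ`
(here the variables `W, X, Y, T` are `X 0, X 1, X 2, X 3`).  Then such a `φ` exists, its
image is exactly the center of 𝓛(ε), and its kernel is the ideal generated by the single
polynomial `(T_l(W) − T)·T − X·Y − 1`. -/
theorem stmt_5 (l : ℕ) (hodd : Odd l) (hl : 3 ≤ l) (ε : ℂ) (hε : IsPrimitiveRoot ε l)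
    (P : Polynomial ℤ)
    (hP : ∀ u : ℂ, u ≠ 0 → Polynomial.aeval (u + u⁻¹) P = u ^ l + u⁻¹ ^ l) :
    (∃ φ : MvPolynomial (Fin 4) ℂ →ₐ[ℂ] Lspec ε,
        φ (MvPolynomial.X 0) = omegaL ε ∧ φ (MvPolynomial.X 1) = lb ε ^ l ∧
        φ (MvPolynomial.X 2) = lc ε ^ l ∧ φ (MvPolynomial.X 3) = ld ε ^ l) ∧
    ∀ φ : MvPolynomial (Fin 4) ℂ →ₐ[ℂ] Lspec ε,
      φ (MvPolynomial.X 0) = omegaL ε → φ (MvPolynomial.X 1) = lb ε ^ l →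
      φ (MvPolynomial.X 2) = lc ε ^ l → φ (MvPolynomial.X 3) = ld ε ^ l →
      Set.range φ = (Subring.center (Lspec ε) : Set (Lspec ε)) ∧
      RingHom.ker (φ : MvPolynomial (Fin 4) ℂ →+* Lspec ε) =
        Ideal.span {(Polynomial.aeval (MvPolynomial.X 0 : MvPolynomial (Fin 4) ℂ) P
            - MvPolynomial.X 3) * MvPolynomial.X 3
            - MvPolynomial.X 1 * MvPolynomial.X 2 - 1} := by
  have hε0 : ε ≠ 0 := hε.ne_zero hodd.pos.ne'
  refine ⟨?_, fun φ h0 h1 h2 h3 => ⟨?_, ?_⟩⟩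
  · obtain ⟨φ, hφ⟩ := exists_center_algHom ![omegaL ε, lb ε ^ l, lc ε ^ l, ld ε ^ l] fun i => by
      fin_cases i
      exacts [omegaL_mem_center hε0, lb_pow_mem_center hodd hε, lc_pow_mem_center hodd hε,
        ld_pow_mem_center hodd hε]
    exact ⟨φ, hφ 0, hφ 1, hφ 2, hφ 3⟩
  · exact congrArg (fun S : Subalgebra ℂ (Lspec ε) => (S : Set (Lspec ε)))
      (range_eq_center φ h0 h3 hodd hε h1 h2)
  · rw [ker_eq_span φ h0 h3 hodd hε h1 h2 P hP, thetaHom_chebyPoly, sub_right_comm]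

end
end
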